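/- Let X be a Banach space and Γ : [0,1] → cwk(X) a multifunction such that 0 ∈ Γ(t) for almost every t ∈ [0,1]. If Γ is Henstock integrable on [0,1], then Γ is McShane integrable on [0,1]; if Γ is ℋ-integrable on [0,1], then Γ is Birkhoff (ℳ-) integrable on [0,1]. -/

import Mathlib

open Set Metric MeasureTheory Pointwise
open scoped ENNReal NNReal

namespace GaugePaper

variable (X : Type*) [NormedAddCommGroup X] [NormedSpace ℝ X]

/-- `A ∈ cwk(X)`: `A` is a nonempty, convex and weakly compact subset of `X`. -/
def IsCWK (A : Set X) : Prop :=
  A.Nonempty ∧ Convex ℝ A ∧ IsCompact (toWeakSpace ℝ X '' A)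

variable {X}

/-- The support function `σ(x*, A)`. -/
noncomputable def suppFn (x' : X →L[ℝ] ℝ) (A : Set X) : ℝ := sSup (x' '' A)

/-- `‖A‖ = sup {‖x‖ : x ∈ A}`. -/
noncomputable def setNorm (A : Set X) : ℝ := sSup ((fun x => ‖x‖) '' A)

/-- A gauge on `[0,1]`: a positive function. -/
def IsGauge (δ : ℝ → ℝ) : Prop := ∀ t ∈ Icc (0:ℝ) 1, 0 < δ t

/-- A tagged partition of `[0,1]` into `n` (possibly degenerate) nonoverlapping closed
subintervals `[pt i, pt (i+1)]`, with tags `tag i ∈ [0,1]`. -/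
structure TP (n : ℕ) where
  pt : Fin (n + 1) → ℝ
  tag : Fin n → ℝ
  mono : Monotone pt
  first : pt 0 = 0
  last : pt (Fin.last n) = 1
  tagMem : ∀ i, tag i ∈ Icc (0:ℝ) 1

namespace TP

variable {n : ℕ} (P : TP n)

/-- The `i`-th subinterval of the partition. -/
def ivl (i : Fin n) : Set ℝ := Icc (P.pt i.castSucc) (P.pt i.succ)

/-- The length `|I_i|` of the `i`-th subinterval. -/
def len (i : Fin n) : ℝ := P.pt i.succ - P.pt i.castSucc

/-- A Perron (Henstock) partition: each tag belongs to its interval. -/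
def IsPerron : Prop := ∀ i, P.tag i ∈ P.ivl i

/-- `δ`-fineness: `I_i ⊆ (t_i - δ(t_i), t_i + δ(t_i))`. -/
def IsFine (δ : ℝ → ℝ) : Prop :=
  ∀ i, P.ivl i ⊆ Ioo (P.tag i - δ (P.tag i)) (P.tag i + δ (P.tag i))

/-- An interior Henstock partition: each tag is in the interior of its interval, except
possibly for intervals containing `0` or `1`, where the tag may also be `0` or `1`. -/
def IsInterior : Prop :=
  ∀ i, P.tag i ∈ Ioo (P.pt i.castSucc) (P.pt i.succ) ∨
    (((0:ℝ) ∈ P.ivl i ∨ (1:ℝ) ∈ P.ivl i) ∧ P.tag i ∈ P.ivl i ∩ ({0, 1} : Set ℝ))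

end TP

/-- Riemann sum of a multifunction: `∑ i |I_i| • Γ(t_i)` (Minkowski sums). -/
def mSum {n : ℕ} (P : TP n) (Γ : ℝ → Set X) : Set X :=
  ∑ i : Fin n, P.len i • Γ (P.tag i)

/-- Riemann sum of a function: `∑ i |I_i| • f(t_i)`. -/
def fSum {n : ℕ} (P : TP n) (f : ℝ → X) : X :=
  ∑ i : Fin n, P.len i • f (P.tag i)

/-! ### Gauge integrals of multifunctions -/

/-- Henstock integrability of a multifunction `Γ : [0,1] → cwk(X)`. -/
def HenstockIntegrable (Γ : ℝ → Set X) : Prop :=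
  ∃ I : Set X, IsCWK X I ∧ ∀ ε > 0, ∃ δ : ℝ → ℝ, IsGauge δ ∧
    ∀ (n : ℕ) (P : TP n), P.IsPerron → P.IsFine δ → hausdorffDist I (mSum P Γ) < ε

/-- McShane integrability of a multifunction (free tags). -/
def McShaneIntegrable (Γ : ℝ → Set X) : Prop :=
  ∃ I : Set X, IsCWK X I ∧ ∀ ε > 0, ∃ δ : ℝ → ℝ, IsGauge δ ∧
    ∀ (n : ℕ) (P : TP n), P.IsFine δ → hausdorffDist I (mSum P Γ) < ε

/-- `ℋ`-integrability: Henstock integrability with Lebesgue measurable gauges. -/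
def HMeasIntegrable (Γ : ℝ → Set X) : Prop :=
  ∃ I : Set X, IsCWK X I ∧ ∀ ε > 0, ∃ δ : ℝ → ℝ, IsGauge δ ∧ AEMeasurable δ volume ∧
    ∀ (n : ℕ) (P : TP n), P.IsPerron → P.IsFine δ → hausdorffDist I (mSum P Γ) < ε

/-- Birkhoff (`ℳ`-) integrability: McShane integrability with Lebesgue measurable gauges. -/
def BirkhoffIntegrable (Γ : ℝ → Set X) : Prop :=
  ∃ I : Set X, IsCWK X I ∧ ∀ ε > 0, ∃ δ : ℝ → ℝ, IsGauge δ ∧ AEMeasurable δ volume ∧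
    ∀ (n : ℕ) (P : TP n), P.IsFine δ → hausdorffDist I (mSum P Γ) < ε

/-! ### Gauge integrals of (single-valued) functions -/

/-- Henstock integrability of a function `f : [0,1] → X`. -/
def FHenstockIntegrable (f : ℝ → X) : Prop :=
  ∃ w : X, ∀ ε > 0, ∃ δ : ℝ → ℝ, IsGauge δ ∧
    ∀ (n : ℕ) (P : TP n), P.IsPerron → P.IsFine δ → ‖w - fSum P f‖ < ε

/-- McShane integrability of a function. -/
def FMcShaneIntegrable (f : ℝ → X) : Prop :=
  ∃ w : X, ∀ ε > 0, ∃ δ : ℝ → ℝ, IsGauge δ ∧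
    ∀ (n : ℕ) (P : TP n), P.IsFine δ → ‖w - fSum P f‖ < ε

/-- `ℋ`-integrability of a function: measurable gauges. -/
def FHMeasIntegrable (f : ℝ → X) : Prop :=
  ∃ w : X, ∀ ε > 0, ∃ δ : ℝ → ℝ, IsGauge δ ∧ AEMeasurable δ volume ∧
    ∀ (n : ℕ) (P : TP n), P.IsPerron → P.IsFine δ → ‖w - fSum P f‖ < ε

/-- Birkhoff (`ℳ`-) integrability of a function: McShane with measurable gauges. -/
def FBirkhoffIntegrable (f : ℝ → X) : Prop :=
  ∃ w : X, ∀ ε > 0, ∃ δ : ℝ → ℝ, IsGauge δ ∧ AEMeasurable δ volume ∧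
    ∀ (n : ℕ) (P : TP n), P.IsFine δ → ‖w - fSum P f‖ < ε

/-- Henstock–Kurzweil integrability of a real-valued function on `[0,1]`. -/
def HKIntegrable (g : ℝ → ℝ) : Prop :=
  ∃ A : ℝ, ∀ ε > 0, ∃ δ : ℝ → ℝ, IsGauge δ ∧
    ∀ (n : ℕ) (P : TP n), P.IsPerron → P.IsFine δ → |fSum P g - A| < ε

/-! ### Pettis integrals -/

/-- Pettis integrability of a function `f : [0,1] → X`. -/
def FPettisIntegrable (f : ℝ → X) : Prop :=
  (∀ x' : X →L[ℝ] ℝ, IntegrableOn (fun t => x' (f t)) (Icc (0:ℝ) 1) volume) ∧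
  ∀ E ⊆ Icc (0:ℝ) 1, NullMeasurableSet E volume →
    ∃ ν : X, ∀ x' : X →L[ℝ] ℝ, x' ν = ∫ t in E, x' (f t)

/-- Pettis integrability of a multifunction `Γ : [0,1] → cwk(X)`. -/
def PettisIntegrable (Γ : ℝ → Set X) : Prop :=
  (∀ x' : X →L[ℝ] ℝ, IntegrableOn (fun t => suppFn x' (Γ t)) (Icc (0:ℝ) 1) volume) ∧
  ∀ E ⊆ Icc (0:ℝ) 1, NullMeasurableSet E volume →
    ∃ W : Set X, IsCWK X W ∧ ∀ x' : X →L[ℝ] ℝ, suppFn x' W = ∫ t in E, suppFn x' (Γ t)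

/-- `f` is a selection of `Γ`. -/
def Selection (Γ : ℝ → Set X) (f : ℝ → X) : Prop := ∀ t ∈ Icc (0:ℝ) 1, f t ∈ Γ t

/-! ### Variational integrals -/

/-- Finite additivity of an interval multifunction on subintervals of `[0,1]`
(an interval `[a,b] ⊆ [0,1]` is encoded by its endpoints). -/
def AdditiveIntervalMF (Φ : ℝ → ℝ → Set X) : Prop :=
  ∀ a b c : ℝ, 0 ≤ a → a ≤ b → b ≤ c → c ≤ 1 → Φ a c = Φ a b + Φ b c

/-- Finite additivity of a vector-valued interval function on subintervals of `[0,1]`. -/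
def AdditiveIntervalF (Φ : ℝ → ℝ → X) : Prop :=
  ∀ a b c : ℝ, 0 ≤ a → a ≤ b → b ≤ c → c ≤ 1 → Φ a c = Φ a b + Φ b c

/-- `Φ` is a variational Henstock primitive of the multifunction `Γ`. -/
def vHPrimitive (Γ : ℝ → Set X) (Φ : ℝ → ℝ → Set X) : Prop :=
  (∀ a b : ℝ, 0 ≤ a → a ≤ b → b ≤ 1 → IsCWK X (Φ a b)) ∧ AdditiveIntervalMF Φ ∧
  ∀ ε > 0, ∃ δ : ℝ → ℝ, IsGauge δ ∧ ∀ (n : ℕ) (P : TP n), P.IsPerron → P.IsFine δ →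
    ∑ i : Fin n, hausdorffDist (Φ (P.pt i.castSucc) (P.pt i.succ)) (P.len i • Γ (P.tag i)) < ε

/-- Variational Henstock integrability of a multifunction. -/
def vHIntegrable (Γ : ℝ → Set X) : Prop := ∃ Φ : ℝ → ℝ → Set X, vHPrimitive Γ Φ

/-- Variational McShane integrability of a multifunction (free tags). -/
def vMSIntegrable (Γ : ℝ → Set X) : Prop :=
  ∃ Φ : ℝ → ℝ → Set X,
    (∀ a b : ℝ, 0 ≤ a → a ≤ b → b ≤ 1 → IsCWK X (Φ a b)) ∧ AdditiveIntervalMF Φ ∧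
    ∀ ε > 0, ∃ δ : ℝ → ℝ, IsGauge δ ∧ ∀ (n : ℕ) (P : TP n), P.IsFine δ →
      ∑ i : Fin n, hausdorffDist (Φ (P.pt i.castSucc) (P.pt i.succ)) (P.len i • Γ (P.tag i)) < ε

/-- Variational `ℋ`-integrability of a multifunction: measurable gauges. -/
def vHMeasIntegrable (Γ : ℝ → Set X) : Prop :=
  ∃ Φ : ℝ → ℝ → Set X,
    (∀ a b : ℝ, 0 ≤ a → a ≤ b → b ≤ 1 → IsCWK X (Φ a b)) ∧ AdditiveIntervalMF Φ ∧
    ∀ ε > 0, ∃ δ : ℝ → ℝ, IsGauge δ ∧ AEMeasurable δ volume ∧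
      ∀ (n : ℕ) (P : TP n), P.IsPerron → P.IsFine δ →
        ∑ i : Fin n, hausdorffDist (Φ (P.pt i.castSucc) (P.pt i.succ)) (P.len i • Γ (P.tag i)) < ε

/-- `Φ` is a variational Henstock primitive of the function `f`. -/
def FvHPrimitive (f : ℝ → X) (Φ : ℝ → ℝ → X) : Prop :=
  AdditiveIntervalF Φ ∧
  ∀ ε > 0, ∃ δ : ℝ → ℝ, IsGauge δ ∧ ∀ (n : ℕ) (P : TP n), P.IsPerron → P.IsFine δ →
    ∑ i : Fin n, ‖Φ (P.pt i.castSucc) (P.pt i.succ) - P.len i • f (P.tag i)‖ < ε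

/-- Variational Henstock integrability of a function. -/
def FvHIntegrable (f : ℝ → X) : Prop := ∃ Φ : ℝ → ℝ → X, FvHPrimitive f Φ

/-- Variational McShane integrability of a function (free tags). -/
def FvMSIntegrable (f : ℝ → X) : Prop :=
  ∃ Φ : ℝ → ℝ → X, AdditiveIntervalF Φ ∧
    ∀ ε > 0, ∃ δ : ℝ → ℝ, IsGauge δ ∧ ∀ (n : ℕ) (P : TP n), P.IsFine δ →
      ∑ i : Fin n, ‖Φ (P.pt i.castSucc) (P.pt i.succ) - P.len i • f (P.tag i)‖ < ε

/-- Variational `ℋ`-integrability of a function: measurable gauges. -/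
def FvHMeasIntegrable (f : ℝ → X) : Prop :=
  ∃ Φ : ℝ → ℝ → X, AdditiveIntervalF Φ ∧
    ∀ ε > 0, ∃ δ : ℝ → ℝ, IsGauge δ ∧ AEMeasurable δ volume ∧
      ∀ (n : ℕ) (P : TP n), P.IsPerron → P.IsFine δ →
        ∑ i : Fin n, ‖Φ (P.pt i.castSucc) (P.pt i.succ) - P.len i • f (P.tag i)‖ < ε

/-! ### Partial Perron partitions and variational measures -/

/-- A finite tagged Perron family of `n` nonoverlapping closed subintervals
`[a i, b i]` of `[0,1]` (a "partition in `[0,1]`", not necessarily covering it). -/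
structure PTP (n : ℕ) where
  a : Fin n → ℝ
  b : Fin n → ℝ
  tag : Fin n → ℝ
  le : ∀ i, a i ≤ b i
  sub : ∀ i, Icc (a i) (b i) ⊆ Icc (0:ℝ) 1
  nonoverlap : ∀ i j, i ≠ j → (Icc (a i) (b i) ∩ Icc (a j) (b j)).Subsingleton
  perron : ∀ i, tag i ∈ Icc (a i) (b i)

/-- `δ`-fineness of a partial Perron family. -/
def PTP.IsFine {n : ℕ} (P : PTP n) (δ : ℝ → ℝ) : Prop :=
  ∀ i, Icc (P.a i) (P.b i) ⊆ Ioo (P.tag i - δ (P.tag i)) (P.tag i + δ (P.tag i))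

/-- `Var(Ψ, δ, E)` for a scalar interval function `Ψ`. -/
noncomputable def scVar (Ψ : ℝ → ℝ → ℝ) (δ : ℝ → ℝ) (E : Set ℝ) : ℝ≥0∞ :=
  ⨆ (n : ℕ) (P : PTP n) (_ : P.IsFine δ ∧ ∀ i, P.tag i ∈ E),
    ∑ i : Fin n, ENNReal.ofReal |Ψ (P.a i) (P.b i)|

/-- The variational measure `V_Ψ(E)` generated by a scalar interval function `Ψ`. -/
noncomputable def scVarMeasure (Ψ : ℝ → ℝ → ℝ) (E : Set ℝ) : ℝ≥0∞ :=
  ⨅ (δ : ℝ → ℝ) (_ : IsGauge δ), scVar Ψ δ E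


/-! ### Cousin's lemma and construction of partitions -/

theorem cousin {p : ℝ → ℝ → Prop} (htrans : ∀ a b c, p a b → p b c → p a c)
    (hloc : ∀ t ∈ Icc (0:ℝ) 1, ∃ r > 0, (∀ a ∈ Icc 0 t, t - r < a → p a t) ∧
      ∀ b ∈ Icc t 1, b < t + r → p t b) : p 0 1 := by
  set s : Set ℝ := {b | b ∈ Icc (0:ℝ) 1 ∧ p 0 b} with hs
  have h0 : (0:ℝ) ∈ s := by
    obtain ⟨r, hr, h, -⟩ := hloc 0 (by simp)
    exact ⟨by simp, h 0 (by simp) (by linarith)⟩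
  have hbdd : BddAbove s := ⟨1, fun b hb => hb.1.2⟩
  have hc0 : 0 ≤ sSup s := le_csSup hbdd h0
  have hc1 : sSup s ≤ 1 := csSup_le ⟨0, h0⟩ fun b hb => hb.1.2
  obtain ⟨r, hr, hl, hR⟩ := hloc (sSup s) ⟨hc0, hc1⟩
  obtain ⟨a, ha, har⟩ := exists_lt_of_lt_csSup ⟨0, h0⟩ (sub_lt_self (sSup s) hr)
  have hpc : p 0 (sSup s) := htrans _ _ _ ha.2 (hl a ⟨ha.1.1, le_csSup hbdd ha⟩ har)
  rcases hc1.eq_or_lt with h | h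
  · rwa [h] at hpc
  · have hb : min 1 (sSup s + r / 2) ∈ s := by
      refine ⟨⟨le_min zero_le_one (by linarith), min_le_left _ _⟩, htrans _ _ _ hpc (hR _ ?_ ?_)⟩
      · exact ⟨le_min hc1 (by linarith), min_le_left _ _⟩
      · exact (min_le_right _ _).trans_lt (by linarith)
    have := le_csSup hbdd hb
    rcases min_le_iff.1 this with h' | h' <;> linarith

/-- `[a, c]` is a finite chain of adjacent tagged intervals satisfying `R`. -/
inductive Chain (R : ℝ → ℝ → ℝ → Prop) : ℝ → ℝ → Prop
  | nil (a : ℝ) : Chain R a a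
  | cons {a b c t : ℝ} (hab : a ≤ b) (h : R a b t) (hc : Chain R b c) : Chain R a c

theorem Chain.trans {R : ℝ → ℝ → ℝ → Prop} {a b c : ℝ} (h : Chain R a b) (h' : Chain R b c) :
    Chain R a c := by
  induction h with
  | nil a => exact h'
  | cons hab h _ ih => exact .cons hab h (ih h')

theorem Chain.single {R : ℝ → ℝ → ℝ → Prop} {a b t : ℝ} (hab : a ≤ b) (h : R a b t) :
    Chain R a b := .cons hab h (.nil b)

theorem Chain.exists_fin {R : ℝ → ℝ → ℝ → Prop} {a c : ℝ} (h : Chain R a c) :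
    ∃ (n : ℕ) (pt : Fin (n + 1) → ℝ) (tag : Fin n → ℝ), Monotone pt ∧ pt 0 = a ∧
      pt (Fin.last n) = c ∧ ∀ i : Fin n, R (pt i.castSucc) (pt i.succ) (tag i) := by
  induction h with
  | nil a => exact ⟨0, fun _ => a, Fin.elim0, monotone_const, rfl, rfl, fun i => i.elim0⟩
  | @cons a b c t hab h _ ih =>
    obtain ⟨n, pt, tag, hm, h0, hl, hR⟩ := ih
    refine ⟨n + 1, Fin.cons a pt, Fin.cons t tag, ?_, rfl, ?_, ?_⟩
    · rw [Fin.monotone_iff_le_succ]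
      intro i
      induction i using Fin.cases with
      | zero => simpa [h0] using hab
      | succ i => simpa using hm i.castSucc_le_succ
    · rw [← Fin.succ_last, Fin.cons_succ, hl]
    · intro i
      induction i using Fin.cases with
      | zero => simpa [h0] using h
      | succ i => simpa using hR i

theorem Chain.exists_TP {R : ℝ → ℝ → ℝ → Prop} (h : Chain R 0 1)
    (hR : ∀ a b t, R a b t → t ∈ Icc (0:ℝ) 1) :
    ∃ (n : ℕ) (P : TP n), ∀ i, R (P.pt i.castSucc) (P.pt i.succ) (P.tag i) := by
  obtain ⟨n, pt, tag, hm, h0, hl, h⟩ := h.exists_fin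
  exact ⟨n, ⟨pt, tag, hm, h0, hl, fun i => hR _ _ _ (h i)⟩, h⟩

namespace TP

variable {n : ℕ} (P : TP n)

theorem exists_castSucc_lt_le {t : ℝ} (h0 : 0 < t) (h1 : t ≤ 1) :
    ∃ j : Fin n, P.pt j.castSucc < t ∧ t ≤ P.pt j.succ := by
  by_contra! h
  have key : ∀ i : Fin (n + 1), P.pt i < t := by
    intro i
    induction i using Fin.induction with
    | zero => simpa [P.first] using h0
    | succ i ih => exact h i ih
  have := key (Fin.last n)
  rw [P.last] at this
  linarith

theorem exists_castSucc_le_lt {t : ℝ} (h0 : 0 ≤ t) (h1 : t < 1) :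
    ∃ j : Fin n, P.pt j.castSucc ≤ t ∧ t < P.pt j.succ := by
  by_contra! h
  have key : ∀ i : Fin (n + 1), P.pt i ≤ t := by
    intro i
    induction i using Fin.induction with
    | zero => simpa [P.first] using h0
    | succ i ih => exact h i ih
  have := key (Fin.last n)
  rw [P.last] at this
  linarith

theorem exists_locally_subset_ivl {t : ℝ} (ht : t ∈ Icc (0:ℝ) 1) :
    ∃ r > 0, (∀ a ∈ Icc 0 t, t - r < a → ∃ j, Icc a t ⊆ P.ivl j) ∧
      ∀ b ∈ Icc t 1, b < t + r → ∃ j, Icc t b ⊆ P.ivl j := by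
  have hl : ∃ r > 0, ∀ a ∈ Icc 0 t, t - r < a → ∃ j, Icc a t ⊆ P.ivl j := by
    rcases ht.1.eq_or_lt with h | h
    · obtain ⟨j, hj, hj'⟩ := P.exists_castSucc_le_lt le_rfl zero_lt_one
      refine ⟨1, one_pos, fun a ha _ => ⟨j, ?_⟩⟩
      subst h
      exact Icc_subset_Icc (hj.trans ha.1) hj'.le
    · obtain ⟨j, hj, hj'⟩ := P.exists_castSucc_lt_le h ht.2
      exact ⟨_, sub_pos.2 hj, fun a _ ha => ⟨j, Icc_subset_Icc (by linarith) hj'⟩⟩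
  have hr : ∃ r > 0, ∀ b ∈ Icc t 1, b < t + r → ∃ j, Icc t b ⊆ P.ivl j := by
    rcases ht.2.eq_or_lt with h | h
    · obtain ⟨j, hj, hj'⟩ := P.exists_castSucc_lt_le zero_lt_one le_rfl
      refine ⟨1, one_pos, fun a ha _ => ⟨j, ?_⟩⟩
      subst h
      exact Icc_subset_Icc hj.le (ha.2.trans hj')
    · obtain ⟨j, hj, hj'⟩ := P.exists_castSucc_le_lt ht.1 h
      exact ⟨_, sub_pos.2 hj', fun a _ ha => ⟨j, Icc_subset_Icc hj (by linarith)⟩⟩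
  obtain ⟨r, hr0, hr⟩ := hr
  obtain ⟨r', hr0', hr'⟩ := hl
  exact ⟨min r r', lt_min hr0 hr0',
    fun a ha h => hr' a ha (by linarith [min_le_right r r']),
    fun b hb h => hr b hb (by linarith [min_le_left r r'])⟩

theorem exists_perron_refining {δ : ℝ → ℝ} (hδ : IsGauge δ) {m : ℕ} (Q : TP m) :
    ∃ (l : ℕ) (R : TP l), R.IsPerron ∧ R.IsFine δ ∧ (∃ β : Fin l → Fin n, ∀ i,
      R.ivl i ⊆ P.ivl (β i)) ∧ ∃ β : Fin l → Fin m, ∀ i, R.ivl i ⊆ Q.ivl (β i) := by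
  let R : ℝ → ℝ → ℝ → Prop := fun a b t => t ∈ Icc (0:ℝ) 1 ∧ t ∈ Icc a b ∧
    Icc a b ⊆ Ioo (t - δ t) (t + δ t) ∧ (∃ j, Icc a b ⊆ P.ivl j) ∧ ∃ j, Icc a b ⊆ Q.ivl j
  have h : Chain R 0 1 := by
    refine cousin (fun _ _ _ => Chain.trans) fun t ht => ?_
    obtain ⟨r, hr, hP, hP'⟩ := P.exists_locally_subset_ivl ht
    obtain ⟨s, hs, hQ, hQ'⟩ := Q.exists_locally_subset_ivl ht
    refine ⟨min (δ t) (min r s), lt_min (hδ t ht) (lt_min hr hs), fun a ha h => ?_,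
      fun b hb h => ?_⟩
    · have h1 : t - δ t < a := by linarith [min_le_left (δ t) (min r s)]
      have h2 : t - r < a := by
        linarith [min_le_right (δ t) (min r s), min_le_left r s]
      have h3 : t - s < a := by
        linarith [min_le_right (δ t) (min r s), min_le_right r s]
      exact .single ha.2 (t := t) ⟨ht, ⟨ha.2, le_rfl⟩,
        Icc_subset_Ioo h1 (by linarith [hδ t ht]), hP a ha h2, hQ a ha h3⟩
    · have h1 : b < t + δ t := by linarith [min_le_left (δ t) (min r s)]
      have h2 : b < t + r := by
        linarith [min_le_right (δ t) (min r s), min_le_left r s]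
      have h3 : b < t + s := by
        linarith [min_le_right (δ t) (min r s), min_le_right r s]
      exact .single hb.1 (t := t) ⟨ht, ⟨le_rfl, hb.1⟩,
        Icc_subset_Ioo (by linarith [hδ t ht]) h1, hP' b hb h2, hQ' b hb h3⟩
  obtain ⟨l, S, hS⟩ := h.exists_TP fun a b t h => h.1
  choose h1 h2 h3 h4 h5 using hS
  choose β hβ using h4
  choose γ hγ using h5
  exact ⟨l, S, h2, h3, ⟨β, hβ⟩, γ, hγ⟩

/-- The partition of `[0,1]` into a single interval tagged at `0`. -/
def trivial : TP 1 where
  pt := fun i => i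
  tag := 0
  mono := fun i j h => Nat.cast_le.2 (Fin.le_def.1 h)
  first := by simp
  last := by simp
  tagMem := by simp

theorem exists_perron {δ : ℝ → ℝ} (hδ : IsGauge δ) :
    ∃ (l : ℕ) (R : TP l), R.IsPerron ∧ R.IsFine δ := by
  obtain ⟨l, R, h, h', -⟩ := trivial.exists_perron_refining hδ trivial
  exact ⟨l, R, h, h'⟩

theorem len_nonneg (i : Fin n) : 0 ≤ P.len i :=
  sub_nonneg.2 (P.mono i.castSucc_le_succ)

theorem pt_mem (i : Fin (n + 1)) : P.pt i ∈ Icc (0:ℝ) 1 :=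
  ⟨P.first ▸ P.mono (Fin.zero_le i), P.last ▸ P.mono (Fin.le_last i)⟩

theorem sum_len : ∑ i, P.len i = 1 := by
  have := Fin.sum_univ_succ P.pt
  have h2 := Fin.sum_univ_castSucc P.pt
  simp only [len, Finset.sum_sub_distrib]
  rw [P.first] at this
  rw [P.last] at h2
  linarith

/-- The `i`-th open subinterval of the partition. -/
def ivo (i : Fin n) : Set ℝ := Ioo (P.pt i.castSucc) (P.pt i.succ)

theorem ivo_subset_ivl (i : Fin n) : P.ivo i ⊆ P.ivl i := Ioo_subset_Icc_self

theorem pairwise_disjoint_ivo : Pairwise (Function.onFun Disjoint P.ivo) := by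
  have key : ∀ i j : Fin n, i < j → Disjoint (P.ivo i) (P.ivo j) := by
    intro i j hij
    rw [Set.disjoint_left]
    intro u hu hu'
    have : P.pt i.succ ≤ P.pt j.castSucc := P.mono (Fin.succ_le_castSucc_iff.2 hij)
    exact absurd (hu.2.trans_le this) hu'.1.not_gt
  intro i j hij
  rcases lt_or_gt_of_ne hij with h | h
  · exact key i j h
  · exact (key j i h).symm

theorem volume_biUnion_ivo (T : Finset (Fin n)) :
    volume (⋃ i ∈ T, P.ivo i) = ENNReal.ofReal (∑ i ∈ T, P.len i) := by
  rw [measure_biUnion_finset (fun i _ j _ h => P.pairwise_disjoint_ivo h)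
    (fun i _ => measurableSet_Ioo), ENNReal.ofReal_sum_of_nonneg fun i _ => P.len_nonneg i]
  simp [ivo, len]

theorem sum_len_le_of_subset {T : Finset (Fin n)} {V : Set ℝ} (hV : ∀ i ∈ T, P.ivo i ⊆ V)
    {c : ℝ} (hc : 0 ≤ c) (hVc : volume V ≤ ENNReal.ofReal c) : ∑ i ∈ T, P.len i ≤ c := by
  rw [← ENNReal.ofReal_le_ofReal_iff hc, ← P.volume_biUnion_ivo]
  exact (measure_mono (iUnion₂_subset hV)).trans hVc

theorem sum_len_mul_of_refines {m : ℕ} (Q : TP m) {β : Fin n → Fin m}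
    (hβ : ∀ i, P.ivl i ⊆ Q.ivl (β i)) (g : Fin m → ℝ) :
    ∑ i, P.len i * g (β i) = ∑ j, Q.len j * g j := by
  have hle : ∀ j ∈ Finset.univ, ∑ i with β i = j, P.len i ≤ Q.len j := by
    intro j _
    refine P.sum_len_le_of_subset (V := Q.ivl j) (fun i hi => ?_) (Q.len_nonneg j) ?_
    · rw [Finset.mem_filter] at hi
      exact (P.ivo_subset_ivl i).trans (hi.2 ▸ hβ i)
    · simp [ivl, len]
  have heq := (Finset.sum_eq_sum_iff_of_le hle).1 (by
    rw [Finset.sum_fiberwise, P.sum_len, Q.sum_len])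
  rw [← Finset.sum_fiberwise (s := Finset.univ) (g := β)]
  refine Finset.sum_congr rfl fun j hj => ?_
  rw [← heq j hj, Finset.sum_mul]
  refine Finset.sum_congr rfl fun i hi => ?_
  rw [(Finset.mem_filter.1 hi).2]

end TP
/-- Given finitely many disjoint tagged intervals in `[0,1]`, there is a tagged partition of `[0,1]`
each of whose intervals is either one of them, or a `δ`-fine Perron interval overlapping none. -/
theorem exists_TP_containing {δ : ℝ → ℝ} (hδ : IsGauge δ) {ι : Type*} (s : Finset ι)
    (l r u : ι → ℝ) (hlr : ∀ i ∈ s, l i < r i) (h01 : ∀ i ∈ s, Icc (l i) (r i) ⊆ Icc (0:ℝ) 1)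
    (hdisj : (s : Set ι).PairwiseDisjoint fun i => Icc (l i) (r i))
    (hu : ∀ i ∈ s, u i ∈ Icc (l i) (r i)) :
    ∃ (n : ℕ) (P : TP n), ∀ j,
      (∃ i ∈ s, P.pt j.castSucc = l i ∧ P.pt j.succ = r i ∧ P.tag j = u i) ∨
      (P.tag j ∈ P.ivl j ∧ P.ivl j ⊆ Ioo (P.tag j - δ (P.tag j)) (P.tag j + δ (P.tag j)) ∧
        ∀ i ∈ s, Disjoint (P.ivo j) (Icc (l i) (r i))) := by
  classical
  let R : ℝ → ℝ → ℝ → Prop := fun a b t => t ∈ Icc (0:ℝ) 1 ∧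
    ((∃ i ∈ s, a = l i ∧ b = r i ∧ t = u i) ∨
      (t ∈ Icc a b ∧ Icc a b ⊆ Ioo (t - δ t) (t + δ t) ∧
        ∀ i ∈ s, Disjoint (Ioo a b) (Icc (l i) (r i))))
  suffices h : Chain R 0 1 by
    obtain ⟨n, P, hP⟩ := h.exists_TP fun a b t h => h.1
    exact ⟨n, P, fun j => (hP j).2⟩
  have huniq : ∀ {i j x}, i ∈ s → j ∈ s → x ∈ Icc (l i) (r i) → x ∈ Icc (l j) (r j) → i = j := by
    intro i j x hi hj hxi hxj
    exact hdisj.elim_set hi hj x hxi hxj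
  -- Each half-open interval is collapsed to its left endpoint.
  let κ : ℝ → ℝ := fun x => if h : ∃ i ∈ s, l i ≤ x ∧ x < r i then l h.choose else x
  have hκ : ∀ {i x}, i ∈ s → l i ≤ x → x < r i → κ x = l i := by
    intro i x hi h1 h2
    have h : ∃ i ∈ s, l i ≤ x ∧ x < r i := ⟨i, hi, h1, h2⟩
    obtain ⟨hj, h3, h4⟩ := h.choose_spec
    simp only [κ, dif_pos h]
    rw [huniq hj hi ⟨h3, h4.le⟩ ⟨h1, h2.le⟩]
  have hκ' : ∀ {x}, (∀ i ∈ s, l i ≤ x → r i ≤ x) → κ x = x := by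
    intro x hx
    have h : ¬ ∃ i ∈ s, l i ≤ x ∧ x < r i := by
      rintro ⟨i, hi, h1, h2⟩
      exact absurd (hx i hi h1) h2.not_ge
    simp only [κ, dif_neg h]
  have hκ0 : κ 0 = 0 := by
    by_cases h : ∃ i ∈ s, l i ≤ 0 ∧ 0 < r i
    · obtain ⟨i, hi, h1, h2⟩ := h
      rw [hκ hi h1 h2]
      exact le_antisymm h1 (h01 i hi ⟨le_rfl, (hlr i hi).le⟩).1
    · push Not at h
      exact hκ' h
  have hκ1 : κ 1 = 1 := by
    refine hκ' fun i hi _ => (h01 i hi ⟨(hlr i hi).le, le_rfl⟩).2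
  suffices h : Chain R (κ 0) (κ 1) by rwa [hκ0, hκ1] at h
  refine cousin (p := fun a b => Chain R (κ a) (κ b)) (fun _ _ _ => Chain.trans) fun t ht => ?_
  have havoid : ∃ ρ > 0, ∀ x, t - ρ < x → x < t + ρ → ∀ i ∈ s, t ∉ Icc (l i) (r i) →
      x ∉ Icc (l i) (r i) := by
    have hC : IsClosed (⋃ i ∈ s.filter (fun i => t ∉ Icc (l i) (r i)), Icc (l i) (r i)) :=
      isClosed_biUnion_finset fun i _ => isClosed_Icc
    have ht' : t ∈ (⋃ i ∈ s.filter (fun i => t ∉ Icc (l i) (r i)), Icc (l i) (r i))ᶜ := by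
      simp only [mem_compl_iff, mem_iUnion, not_exists]
      exact fun i hi h => (Finset.mem_filter.1 hi).2 h
    obtain ⟨ρ, hρ, h⟩ := Metric.isOpen_iff.1 hC.isOpen_compl t ht'
    refine ⟨ρ, hρ, fun x h1 h2 i hi hti hxi => ?_⟩
    refine h (Real.ball_eq_Ioo t ρ ▸ ⟨h1, h2⟩ : x ∈ ball t ρ) ?_
    exact mem_biUnion (show i ∈ s.filter _ from Finset.mem_filter.2 ⟨hi, hti⟩) hxi
  obtain ⟨ρ, hρ, havoid⟩ := havoid
  have hδt := hδ t ht
  by_cases hex : ∃ i ∈ s, t ∈ Icc (l i) (r i)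
  · obtain ⟨i, hi, hti⟩ := hex
    have hoth : ∀ j ∈ s, j ≠ i → t ∉ Icc (l j) (r j) := fun j hj hne h =>
      hne (huniq hj hi h hti)
    have hav : ∀ x, t - ρ < x → x < t + ρ → x ∉ Icc (l i) (r i) → ∀ j ∈ s,
        x ∉ Icc (l j) (r j) := by
      intro x h1 h2 h3 j hj
      by_cases hji : j = i
      · rwa [hji]
      · exact havoid x h1 h2 j hj (hoth j hj hji)
    have hav' : ∀ x, t - ρ < x → x < t + ρ → x ∉ Icc (l i) (r i) → κ x = x := by
      intro x h1 h2 h3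
      exact hκ' fun j hj hx => le_of_not_ge fun h => hav x h1 h2 h3 j hj ⟨hx, h⟩
    have hL : ∃ σ > 0, ∀ a ∈ Icc 0 t, t - σ < a → Chain R (κ a) (κ t) := by
      rcases hti.1.eq_or_lt with h | h
      · refine ⟨min ρ (δ t), lt_min hρ hδt, fun a ha hat => ?_⟩
        rcases ha.2.eq_or_lt with rfl | hlt
        · exact .nil _
        · have h1 : t - ρ < a := by linarith [min_le_left ρ (δ t)]
          have h2 : t - δ t < a := by linarith [min_le_right ρ (δ t)]
          rw [hκ hi hti.1 (h ▸ hlr i hi), hav' a h1 (by linarith) fun h' => by linarith [h'.1], h]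
          refine .single ha.2 (t := t) ⟨ht, .inr ⟨⟨ha.2, le_rfl⟩,
            Icc_subset_Ioo h2 (by linarith), fun j hj => ?_⟩⟩
          rw [Set.disjoint_left]
          exact fun x hx => hav x (h1.trans hx.1) (by linarith [hx.2])
            (fun h' => by linarith [h'.1, hx.2]) j hj
      · refine ⟨t - l i, by linarith, fun a ha hat => ?_⟩
        rcases ha.2.eq_or_lt with rfl | hlt
        · exact .nil _
        · rw [hκ hi (by linarith) (hlt.trans_le hti.2)]
          rcases hti.2.eq_or_lt with h' | h'
          · rw [hκ' fun j hj hjt => ?_]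
            · exact .single (t := u i) h.le ⟨h01 i hi (hu i hi), .inl ⟨i, hi, rfl, h', rfl⟩⟩
            · by_cases hji : j = i
              · exact hji ▸ h'.ge
              · exact le_of_not_ge fun h => hoth j hj hji ⟨hjt, h⟩
          · rw [hκ hi hti.1 h']
            exact .nil _
    have hR : ∃ σ > 0, ∀ b ∈ Icc t 1, b < t + σ → Chain R (κ t) (κ b) := by
      rcases hti.2.eq_or_lt with h | h
      · refine ⟨min ρ (δ t), lt_min hρ hδt, fun b hb hbt => ?_⟩
        rcases hb.1.eq_or_lt with rfl | hlt
        · exact .nil _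
        · have h1 : b < t + ρ := by linarith [min_le_left ρ (δ t)]
          have h2 : b < t + δ t := by linarith [min_le_right ρ (δ t)]
          have h3 : κ t = t := hκ' fun j hj hjt => by
            by_cases hji : j = i
            · exact hji ▸ h.ge
            · exact le_of_not_ge fun h => hoth j hj hji ⟨hjt, h⟩
          rw [h3, hav' b (by linarith) h1 fun h' => by linarith [h'.2]]
          refine .single hb.1 (t := t) ⟨ht, .inr ⟨⟨le_rfl, hb.1⟩,
            Icc_subset_Ioo (by linarith) h2, fun j hj => ?_⟩⟩
          rw [Set.disjoint_left]
          exact fun x hx => hav x (by linarith [hx.1]) (hx.2.trans h1)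
            (fun h' => by linarith [h'.2, hx.1]) j hj
      · refine ⟨r i - t, by linarith, fun b hb hbt => ?_⟩
        rw [hκ hi hti.1 h, hκ hi (hti.1.trans hb.1) (by linarith)]
        exact .nil _
    obtain ⟨σ, hσ, hL⟩ := hL
    obtain ⟨τ, hτ, hR⟩ := hR
    exact ⟨min σ τ, lt_min hσ hτ, fun a ha h => hL a ha (by linarith [min_le_left σ τ]),
      fun b hb h => hR b hb (by linarith [min_le_right σ τ])⟩
  · push Not at hex
    have hav : ∀ x, t - ρ < x → x < t + ρ → ∀ j ∈ s, x ∉ Icc (l j) (r j) :=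
      fun x h1 h2 j hj => havoid x h1 h2 j hj (hex j hj)
    have hav' : ∀ x, t - ρ < x → x < t + ρ → κ x = x := by
      intro x h1 h2
      exact hκ' fun j hj hx => le_of_not_ge fun h => hav x h1 h2 j hj ⟨hx, h⟩
    refine ⟨min ρ (δ t), lt_min hρ hδt, fun a ha hat => ?_, fun b hb hbt => ?_⟩
    · have h1 : t - ρ < a := by linarith [min_le_left ρ (δ t)]
      have h2 : t - δ t < a := by linarith [min_le_right ρ (δ t)]
      rw [hav' a h1 (by linarith [ha.2]), hav' t (by linarith) (by linarith)]
      refine .single ha.2 (t := t) ⟨ht, .inr ⟨⟨ha.2, le_rfl⟩,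
        Icc_subset_Ioo h2 (by linarith), fun j hj => ?_⟩⟩
      rw [Set.disjoint_left]
      exact fun x hx => hav x (h1.trans hx.1) (by linarith [hx.2]) j hj
    · have h1 : b < t + ρ := by linarith [min_le_left ρ (δ t)]
      have h2 : b < t + δ t := by linarith [min_le_right ρ (δ t)]
      rw [hav' b (by linarith [hb.1]) h1, hav' t (by linarith) (by linarith)]
      refine .single hb.1 (t := t) ⟨ht, .inr ⟨⟨le_rfl, hb.1⟩,
        Icc_subset_Ioo (by linarith) h2, fun j hj => ?_⟩⟩
      rw [Set.disjoint_left]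
      exact fun x hx => hav x (by linarith [hx.1]) (hx.2.trans h1) j hj

/-- Every `δ`-fine Perron sum of `g` is within `ε` of `A`. -/
def PerronClose (δ : ℝ → ℝ) (g : ℝ → ℝ) (A ε : ℝ) : Prop :=
  ∀ (n : ℕ) (P : TP n), P.IsPerron → P.IsFine δ → |fSum P g - A| ≤ ε

theorem PerronClose.sum_sub_le {δ g : ℝ → ℝ} {A ε : ℝ} (h : PerronClose δ g A ε) {n : ℕ}
    {P : TP n} (hP : P.IsPerron) (hf : P.IsFine δ) {v : Fin n → ℝ} {T : Finset (Fin n)}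
    (hv : ∀ j ∈ T, v j ∈ Icc (0:ℝ) 1) (hv' : ∀ j ∈ T, v j ∈ P.ivl j)
    (hvδ : ∀ j ∈ T, P.ivl j ⊆ Ioo (v j - δ (v j)) (v j + δ (v j))) :
    |∑ j ∈ T, P.len j * (g (P.tag j) - g (v j))| ≤ 2 * ε := by
  classical
  let P' : TP n := { P with
    tag := fun j => if j ∈ T then v j else P.tag j
    tagMem := fun j => by
      split_ifs with hj
      exacts [hv j hj, P.tagMem j] }
  have h1 := h n P hP hf
  have h2 : |fSum P' g - A| ≤ ε := by
    refine h n P' (fun j => ?_) (fun j => ?_)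
    · by_cases hj : j ∈ T
      · simpa [P', hj, TP.ivl] using hv' j hj
      · simpa [P', hj, TP.ivl] using hP j
    · by_cases hj : j ∈ T
      · simpa [P', hj, TP.ivl] using hvδ j hj
      · simpa [P', hj, TP.ivl] using hf j
  have h3 : fSum P g - fSum P' g = ∑ j ∈ T, P.len j * (g (P.tag j) - g (v j)) := by
    simp only [fSum, smul_eq_mul, ← Finset.sum_sub_distrib]
    rw [← Finset.sum_subset (Finset.subset_univ T)]
    · refine Finset.sum_congr rfl fun j hj => ?_
      simp only [P', hj, if_true, TP.len]
      ring
    · intro j _ hj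
      simp [P', hj, TP.len]
  rw [← h3]
  rw [abs_le] at *
  constructor <;> linarith

theorem PerronClose.sum_le {δ : ℝ → ℝ} (hδ : IsGauge δ) {g : ℝ → ℝ} {A ε : ℝ}
    (h : PerronClose δ g A ε) {ι : Type*} (s : Finset ι)
    (l r u v : ι → ℝ) (hlr : ∀ i ∈ s, l i < r i) (h01 : ∀ i ∈ s, Icc (l i) (r i) ⊆ Icc (0:ℝ) 1)
    (hdisj : (s : Set ι).PairwiseDisjoint fun i => Icc (l i) (r i))
    (hu : ∀ i ∈ s, u i ∈ Icc (l i) (r i)) (hv : ∀ i ∈ s, v i ∈ Icc (l i) (r i))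
    (huδ : ∀ i ∈ s, Icc (l i) (r i) ⊆ Ioo (u i - δ (u i)) (u i + δ (u i)))
    (hvδ : ∀ i ∈ s, Icc (l i) (r i) ⊆ Ioo (v i - δ (v i)) (v i + δ (v i))) :
    ∑ i ∈ s, (r i - l i) * (g (u i) - g (v i)) ≤ 2 * ε := by
  classical
  obtain ⟨n, P, hP⟩ := exists_TP_containing hδ s l r u hlr h01 hdisj hu
  let p : Fin n → ι → Prop := fun j i =>
    i ∈ s ∧ P.pt j.castSucc = l i ∧ P.pt j.succ = r i ∧ P.tag j = u i
  let T : Finset (Fin n) := Finset.univ.filter fun j => ∃ i, p j i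
  have hT : ∀ j : T, ∃ i, p j i := fun j => (Finset.mem_filter.1 j.2).2
  choose e he using hT
  have hperron : P.IsPerron := by
    intro j
    rcases hP j with ⟨i, hi, h1, h2, h3⟩ | h
    · rw [TP.ivl, h1, h2, h3]; exact hu i hi
    · exact h.1
  have hfine : P.IsFine δ := by
    intro j
    rcases hP j with ⟨i, hi, h1, h2, h3⟩ | h
    · rw [TP.ivl, h1, h2, h3]; exact huδ i hi
    · exact h.2.1
  let w : Fin n → ℝ := fun j => if hj : j ∈ T then v (e ⟨j, hj⟩) else 0
  have hw : ∀ j (hj : j ∈ T), w j = v (e ⟨j, hj⟩) := fun j hj => dif_pos hj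
  have key := h.sum_sub_le hperron hfine (v := w) (T := T)
    (fun j hj => by
      rw [hw j hj]
      exact h01 _ (he ⟨j, hj⟩).1 (hv _ (he ⟨j, hj⟩).1))
    (fun j hj => by
      obtain ⟨h1, h2, h3, -⟩ := he ⟨j, hj⟩
      rw [hw j hj, TP.ivl, h2, h3]
      exact hv _ h1)
    (fun j hj => by
      obtain ⟨h1, h2, h3, -⟩ := he ⟨j, hj⟩
      rw [hw j hj, TP.ivl, h2, h3]
      exact hvδ _ h1)
  refine le_of_eq_of_le ?_ ((le_abs_self _).trans key)
  symm
  refine Finset.sum_bij (fun j hj => e ⟨j, hj⟩) (fun j hj => (he ⟨j, hj⟩).1) ?_ ?_ ?_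
  · intro j hj j' hj' hee
    by_contra hne
    obtain ⟨h1, h2, h3, -⟩ := he ⟨j, hj⟩
    obtain ⟨-, h2', h3', -⟩ := he ⟨j', hj'⟩
    have hd := P.pairwise_disjoint_ivo hne
    simp only [Function.onFun, TP.ivo] at hd
    dsimp only at h2 h3 h2' h3' hee
    rw [h2, h3, h2', h3', ← hee, disjoint_self] at hd
    exact (nonempty_Ioo.2 (hlr _ h1)).ne_empty hd
  · intro i hi
    have hlri := hlr i hi
    have hl0 := (h01 i hi ⟨le_rfl, hlri.le⟩).1
    have hr1 := (h01 i hi ⟨hlri.le, le_rfl⟩).2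
    obtain ⟨j, hj1, hj2⟩ := P.exists_castSucc_lt_le (t := (l i + r i) / 2)
      (by linarith) (by linarith)
    have hj : j ∈ T := by
      rcases hP j with ⟨i', hi'⟩ | hj'
      · exact Finset.mem_filter.2 ⟨Finset.mem_univ _, i', hi'⟩
      · exfalso
        obtain ⟨y, hy1, hy2⟩ := exists_between
          (max_lt hj1 (by linarith : l i < (l i + r i) / 2))
        exact Set.disjoint_left.1 (hj'.2.2 i hi)
          (⟨(le_max_left _ _).trans_lt hy1, hy2.trans_le hj2⟩ : y ∈ P.ivo j)
          ⟨((le_max_right _ _).trans_lt hy1).le, by linarith⟩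
    refine ⟨j, hj, ?_⟩
    obtain ⟨h1, h2, h3, -⟩ := he ⟨j, hj⟩
    exact hdisj.elim_set h1 hi ((l i + r i) / 2) ⟨h2 ▸ hj1.le, h3 ▸ hj2⟩
      ⟨by linarith, by linarith⟩
  · intro j hj
    obtain ⟨h1, h2, h3, h4⟩ := he ⟨j, hj⟩
    dsimp only at h2 h3 h4
    rw [hw j hj, TP.len, h2, h3, h4]

theorem PerronClose.mul_sum_len_le {δ : ℝ → ℝ} (hδ : IsGauge δ) {g : ℝ → ℝ} {A ε : ℝ}
    (h : PerronClose δ g A ε) {n : ℕ} (P : TP n) (T : Finset (Fin n))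
    (l r u v : Fin n → ℝ) (hpos : ∀ i ∈ T, 0 < P.len i)
    (hQ : ∀ i ∈ T, P.ivl i ⊆ Icc (l i) (r i)) (h01 : ∀ i ∈ T, Icc (l i) (r i) ⊆ Icc (0:ℝ) 1)
    (hu : ∀ i ∈ T, u i ∈ Icc (l i) (r i)) (hv : ∀ i ∈ T, v i ∈ Icc (l i) (r i))
    (huδ : ∀ i ∈ T, Icc (l i) (r i) ⊆ Ioo (u i - δ (u i)) (u i + δ (u i)))
    (hvδ : ∀ i ∈ T, Icc (l i) (r i) ⊆ Ioo (v i - δ (v i)) (v i + δ (v i)))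
    {c : ℝ} (hc : 0 ≤ c) (hosc : ∀ i ∈ T, c ≤ |g (u i) - g (v i)|) :
    c * ∑ i ∈ T, P.len i ≤ 10 * ε := by
  classical
  wlog huv : ∀ i ∈ T, c ≤ g (u i) - g (v i) generalizing u v
  · refine this (fun i => if g (v i) ≤ g (u i) then u i else v i)
      (fun i => if g (v i) ≤ g (u i) then v i else u i) ?_ ?_ ?_ ?_ ?_ ?_ <;> intro i hi <;>
      split_ifs with hi'
    all_goals first | exact hu i hi | exact hv i hi | exact huδ i hi | exact hvδ i hi | skip
    · exact hosc i hi
    · rw [abs_sub_comm]; exact hosc i hi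
    · simpa [abs_of_nonneg (sub_nonneg.2 hi')] using hosc i hi
    · simpa [abs_of_neg (sub_neg.2 (not_le.1 hi'))] using hosc i hi
  have hlr : ∀ i ∈ T, l i < r i := by
    intro i hi
    have h1 := hpos i hi
    have h2 : P.pt i.castSucc ≤ P.pt i.succ := P.mono i.castSucc_le_succ
    have h3 := hQ i hi (left_mem_Icc.2 h2)
    have h4 := hQ i hi (right_mem_Icc.2 h2)
    rw [TP.len] at h1
    linarith [h3.1, h4.2]
  obtain ⟨U, hUT, hUd, hU⟩ := Vitali.exists_disjoint_subfamily_covering_enlargement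
    (fun i => Icc (l i) (r i)) (T : Set (Fin n)) (fun i => r i - l i) 2 one_lt_two
    (fun i hi => sub_nonneg.2 (hlr i hi).le) 1
    (fun i hi => by
      have h1 := h01 i hi (left_mem_Icc.2 (hlr i hi).le)
      have h2 := h01 i hi (right_mem_Icc.2 (hlr i hi).le)
      linarith [h1.1, h2.2])
    (fun i hi => nonempty_Icc.2 (hlr i hi).le)
  set S : Finset (Fin n) := T.filter (· ∈ U) with hS
  have hST : ∀ i ∈ S, i ∈ T := fun i hi => (Finset.mem_filter.1 hi).1
  have hSU : ∀ i ∈ S, i ∈ U := fun i hi => (Finset.mem_filter.1 hi).2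
  have h1 := h.sum_le hδ S l r u v (fun i hi => hlr i (hST i hi)) (fun i hi => h01 i (hST i hi))
    (fun i hi j hj hij => hUd (hSU i hi) (hSU j hj) hij)
    (fun i hi => hu i (hST i hi)) (fun i hi => hv i (hST i hi))
    (fun i hi => huδ i (hST i hi)) (fun i hi => hvδ i (hST i hi))
  have h2 : ∑ i ∈ T, P.len i ≤ ∑ i ∈ S, 5 * (r i - l i) := by
    have hnn : ∀ i ∈ S, 0 ≤ 5 * (r i - l i) := fun i hi => by linarith [hlr i (hST i hi)]
    refine P.sum_len_le_of_subset
      (V := ⋃ i ∈ S, Icc (l i - 2 * (r i - l i)) (r i + 2 * (r i - l i))) (fun i hi => ?_)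
      (Finset.sum_nonneg hnn) ?_
    · obtain ⟨j, hj, ⟨x, hxi, hxj⟩, hij⟩ := hU i hi
      have hjS : j ∈ S := Finset.mem_filter.2 ⟨hUT hj, hj⟩
      intro y hy
      have hy' := hQ i hi (P.ivo_subset_ivl i hy)
      refine mem_biUnion (show j ∈ (S : Set (Fin n)) from hjS) ?_
      constructor <;> linarith [hy'.1, hy'.2, hxi.1, hxi.2, hxj.1, hxj.2]
    · refine (measure_biUnion_finset_le _ _).trans ?_
      rw [ENNReal.ofReal_sum_of_nonneg hnn]
      refine Finset.sum_le_sum fun i _ => ?_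
      rw [Real.volume_Icc]
      exact ENNReal.ofReal_le_ofReal (by linarith)
  have h3 : ∑ i ∈ S, c * (r i - l i) ≤ ∑ i ∈ S, (r i - l i) * (g (u i) - g (v i)) := by
    refine Finset.sum_le_sum fun i hi => ?_
    rw [mul_comm]
    exact mul_le_mul_of_nonneg_left (huv i (hST i hi)) (sub_nonneg.2 (hlr i (hST i hi)).le)
  calc c * ∑ i ∈ T, P.len i ≤ c * ∑ i ∈ S, 5 * (r i - l i) := mul_le_mul_of_nonneg_left h2 hc
    _ = 5 * ∑ i ∈ S, c * (r i - l i) := by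
      rw [Finset.mul_sum, Finset.mul_sum]
      exact Finset.sum_congr rfl fun i _ => by ring
    _ ≤ 10 * ε := by linarith

theorem PerronClose.sum_len_mul_abs_le {δ : ℝ → ℝ} (hδ : IsGauge δ) {g : ℝ → ℝ} {A ε : ℝ}
    (h : PerronClose δ g A ε) {n : ℕ} (P : TP n) (T : Finset (Fin n))
    (l r u v : Fin n → ℝ)
    (hQ : ∀ i ∈ T, P.ivl i ⊆ Icc (l i) (r i)) (h01 : ∀ i ∈ T, Icc (l i) (r i) ⊆ Icc (0:ℝ) 1)
    (hu : ∀ i ∈ T, u i ∈ Icc (l i) (r i)) (hv : ∀ i ∈ T, v i ∈ Icc (l i) (r i))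
    (huδ : ∀ i ∈ T, Icc (l i) (r i) ⊆ Ioo (u i - δ (u i)) (u i + δ (u i)))
    (hvδ : ∀ i ∈ T, Icc (l i) (r i) ⊆ Ioo (v i - δ (v i)) (v i + δ (v i)))
    {b : ℝ} (hgu : ∀ i ∈ T, |g (u i)| ≤ b) (hgv : ∀ i ∈ T, |g (v i)| ≤ b)
    (hb : 0 ≤ b) {c : ℝ} (hc : 0 < c) :
    ∑ i ∈ T, P.len i * |g (u i) - g (v i)| ≤ c + 2 * b * (10 * ε / c) := by
  classical
  set S := T.filter fun i => 0 < P.len i ∧ c ≤ |g (u i) - g (v i)| with hS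
  have hST : ∀ i ∈ S, i ∈ T := fun i hi => (Finset.mem_filter.1 hi).1
  have h1 := h.mul_sum_len_le hδ P S l r u v (fun i hi => (Finset.mem_filter.1 hi).2.1)
    (fun i hi => hQ i (hST i hi)) (fun i hi => h01 i (hST i hi))
    (fun i hi => hu i (hST i hi)) (fun i hi => hv i (hST i hi))
    (fun i hi => huδ i (hST i hi)) (fun i hi => hvδ i (hST i hi)) hc.le
    (fun i hi => (Finset.mem_filter.1 hi).2.2)
  have h2 : ∑ i ∈ S, P.len i * |g (u i) - g (v i)| ≤ 2 * b * (10 * ε / c) := by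
    calc ∑ i ∈ S, P.len i * |g (u i) - g (v i)| ≤ ∑ i ∈ S, P.len i * (2 * b) := by
          refine Finset.sum_le_sum fun i hi => mul_le_mul_of_nonneg_left ?_ (P.len_nonneg i)
          have := abs_sub (g (u i)) (g (v i))
          linarith [hgu i (hST i hi), hgv i (hST i hi)]
      _ = 2 * b * ∑ i ∈ S, P.len i := by rw [← Finset.sum_mul, mul_comm]
      _ ≤ _ := by
        refine mul_le_mul_of_nonneg_left ?_ (by linarith)
        rw [le_div_iff₀ hc]
        linarith
  have h3 : ∑ i ∈ T.filter (fun i => ¬(0 < P.len i ∧ c ≤ |g (u i) - g (v i)|)),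
      P.len i * |g (u i) - g (v i)| ≤ c := by
    calc _ ≤ ∑ i ∈ T.filter (fun i => ¬(0 < P.len i ∧ c ≤ |g (u i) - g (v i)|)), P.len i * c := by
          refine Finset.sum_le_sum fun i hi => ?_
          have := (Finset.mem_filter.1 hi).2
          rcases (P.len_nonneg i).eq_or_lt with h0 | h0
          · simp [← h0]
          · exact mul_le_mul_of_nonneg_left (not_le.1 fun h => this ⟨h0, h⟩).le h0.le
      _ ≤ ∑ i, P.len i * c := Finset.sum_le_sum_of_subset_of_nonneg (Finset.subset_univ _)
          fun i _ _ => mul_nonneg (P.len_nonneg i) hc.le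
      _ = c := by rw [← Finset.sum_mul, P.sum_len, one_mul]
  rw [← Finset.sum_filter_add_sum_filter_not T
    (fun i => 0 < P.len i ∧ c ≤ |g (u i) - g (v i)|)]
  linarith
theorem sum_le_of_fiber_le {α κ : Type*} [DecidableEq κ] (T : Finset α) (c : α → κ) (w : α → ℝ)
    {e : κ → ℝ} {E : ℝ} (he : ∀ k, 0 ≤ e k) (hE : HasSum e E)
    (h : ∀ k, ∑ i ∈ T with c i = k, w i ≤ e k) : ∑ i ∈ T, w i ≤ E := by
  rw [← Finset.sum_fiberwise_of_maps_to (fun i hi => Finset.mem_image_of_mem c hi) w]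
  exact (Finset.sum_le_sum fun k _ => h k).trans (sum_le_hasSum _ (fun k _ => he k) hE)

theorem aemeasurable_apply_index {κ : Type*} [Countable κ] [MeasurableSpace κ]
    [MeasurableSingletonClass κ] {k : ℝ → κ} (hk : AEMeasurable k volume) {f : κ → ℝ → ℝ}
    (hf : ∀ j, AEMeasurable (f j) volume) : AEMeasurable (fun t => f (k t) t) volume := by
  have h1 : Measurable fun p : κ × ℝ => (hf p.1).mk (f p.1) p.2 :=
    measurable_from_prod_countable_right fun j => (hf j).measurable_mk
  refine (h1.comp_aemeasurable (hk.prodMk aemeasurable_id)).congr ?_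
  have h2 : ∀ᵐ t ∂(volume : Measure ℝ), ∀ j, f j t = (hf j).mk (f j) t :=
    ae_all_iff.2 fun j => (hf j).ae_eq_mk
  filter_upwards [h2] with t ht
  exact (ht (k t)).symm

/-- A uniformly Henstock integrable family is bounded where the gauge is bounded below. -/
theorem exists_bound_of_perronClose {ι : Type*} {F : ι → ℝ → ℝ} {φ : ι → ℝ} {δ : ℝ → ℝ} {ε : ℝ}
    (hδ : IsGauge δ) (hF : ∀ t ∈ Icc (0:ℝ) 1, ∃ b, ∀ x, |F x t| ≤ b)
    (h : ∀ x, PerronClose δ (F x) (φ x) ε) {k : ℝ} (hk : 0 < k) :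
    ∃ B, ∀ t ∈ Icc (0:ℝ) 1, (δ t)⁻¹ ≤ k → ∀ x, |F x t| ≤ B := by
  have key : ∃ B, ∀ t ∈ Icc (0:ℝ) 1, t ∈ Icc (0:ℝ) 1 → (δ t)⁻¹ ≤ k → ∀ x, |F x t| ≤ B := by
    refine isCompact_Icc.induction_on
      (p := fun s => ∃ B, ∀ t ∈ s, t ∈ Icc (0:ℝ) 1 → (δ t)⁻¹ ≤ k → ∀ x, |F x t| ≤ B)
      ⟨0, by simp⟩ ?_ ?_ ?_
    · rintro s t hst ⟨B, hB⟩
      exact ⟨B, fun y hy => hB y (hst hy)⟩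
    · rintro s t ⟨B, hB⟩ ⟨C, hC⟩
      refine ⟨max B C, fun y hy hy1 hy2 x => ?_⟩
      rcases hy with hy | hy
      exacts [(hB y hy hy1 hy2 x).trans (le_max_left _ _),
        (hC y hy hy1 hy2 x).trans (le_max_right _ _)]
    · intro u hu
      have hr : 0 < k⁻¹ / 4 := by positivity
      set r := k⁻¹ / 4 with hr'
      have hkr : k⁻¹ = 4 * r := by rw [hr']; ring
      refine ⟨Ioo (u - r) (u + r), mem_nhdsWithin_of_mem_nhds
        (Ioo_mem_nhds (by linarith) (by linarith)), ?_⟩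
      by_cases hs : ∃ s ∈ Ioo (u - r) (u + r), s ∈ Icc (0:ℝ) 1 ∧ (δ s)⁻¹ ≤ k
      · obtain ⟨s, hs1, hs2, hs3⟩ := hs
        obtain ⟨b, hb⟩ := hF s hs2
        set l' := max (u - r) 0 with hl'
        set r' := min (u + r) 1 with hr''
        have hlr : l' < r' := by
          refine max_lt (lt_min ?_ ?_) (lt_min ?_ ?_) <;> linarith [hu.1, hu.2]
        have hl1 := le_max_left (u - r) 0
        have hl2 := le_max_right (u - r) 0
        have hr1 := min_le_left (u + r) 1
        have hr2 := min_le_right (u + r) 1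
        have hmem : ∀ t ∈ Ioo (u - r) (u + r), t ∈ Icc (0:ℝ) 1 → t ∈ Icc l' r' :=
          fun t ht ht' => ⟨max_le ht.1.le ht'.1, le_min ht.2.le ht'.2⟩
        have hfine : ∀ t ∈ Ioo (u - r) (u + r), t ∈ Icc (0:ℝ) 1 → (δ t)⁻¹ ≤ k →
            Icc l' r' ⊆ Ioo (t - δ t) (t + δ t) := by
          intro t ht ht' htk
          have := inv_le_of_inv_le₀ (hδ t ht') htk
          refine Icc_subset_Ioo ?_ ?_ <;> linarith [ht.1, ht.2]
        refine ⟨b + 2 * ε / (r' - l'), fun t ht ht1 ht2 x => ?_⟩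
        have main : ∀ y z, y ∈ Ioo (u - r) (u + r) → y ∈ Icc (0:ℝ) 1 → (δ y)⁻¹ ≤ k →
            z ∈ Ioo (u - r) (u + r) → z ∈ Icc (0:ℝ) 1 → (δ z)⁻¹ ≤ k →
            F x y - F x z ≤ 2 * ε / (r' - l') := by
          intro y z hy hy1 hy2 hz hz1 hz2
          have := (h x).sum_le hδ {()} (fun _ => l') (fun _ => r') (fun _ => y) (fun _ => z)
            (by simpa using hlr) (fun _ _ => Icc_subset_Icc hl2 hr2) (by simp)
            (by simpa using hmem y hy hy1) (by simpa using hmem z hz hz1)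
            (fun _ _ => hfine y hy hy1 hy2) (fun _ _ => hfine z hz hz1 hz2)
          rw [le_div_iff₀ (by linarith)]
          simp only [Finset.sum_singleton] at this
          linarith
        have h1 := main t s ht ht1 ht2 hs1 hs2 hs3
        have h2 := main s t hs1 hs2 hs3 ht ht1 ht2
        have h3 := abs_le.1 (hb x)
        rw [abs_le]
        constructor <;> linarith [h3.1, h3.2]
      · push Not at hs
        exact ⟨0, fun t ht ht1 ht2 => absurd ht2 (not_le.2 (hs t ht ht1))⟩
  obtain ⟨B, hB⟩ := key
  exact ⟨B, fun t ht => hB t ht ht⟩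

theorem TP.sum_len_le_of_disjoint {n : ℕ} (P : TP n) {T : Finset (Fin n)} {A G : Set ℝ} {c : ℝ}
    (hc : 0 ≤ c) (hA : volume A ≠ ∞) (hAG : A ⊆ G) (hG : volume G ≤ volume A + ENNReal.ofReal c)
    (hTG : ∀ i ∈ T, P.ivo i ⊆ G) (hTA : ∀ i ∈ T, Disjoint (P.ivo i) A) :
    ∑ i ∈ T, P.len i ≤ c := by
  refine P.sum_len_le_of_subset (V := ⋃ i ∈ T, P.ivo i)
    (fun i hi => subset_biUnion_of_mem (u := P.ivo) (show i ∈ (T : Set (Fin n)) from hi)) hc ?_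
  set V := ⋃ i ∈ T, P.ivo i with hV
  have hVm : MeasurableSet V := T.measurableSet_biUnion fun i _ => measurableSet_Ioo
  have hVA : Disjoint V A := by
    simp only [hV, disjoint_iUnion_left]
    exact hTA
  have h1 : volume V + volume A ≤ volume A + ENNReal.ofReal c := by
    rw [← measure_union' hVA hVm]
    exact (measure_mono (union_subset (iUnion₂_subset hTG) hAG)).trans hG
  rw [add_comm] at h1
  exact (ENNReal.add_le_add_iff_left hA).1 h1

theorem exists_isOpen_volume_le {A : Set ℝ} (hA : volume A ≠ ∞) {θ : ℝ} (hθ : 0 < θ) :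
    ∃ G, A ⊆ G ∧ IsOpen G ∧ volume G ≤ volume A + ENNReal.ofReal θ ∧ Gᶜ.Nonempty := by
  obtain ⟨G, hAG, hG, hlt⟩ := A.exists_isOpen_lt_add hA (ENNReal.ofReal_pos.2 hθ).ne'
  refine ⟨G, hAG, hG, hlt.le, nonempty_compl.2 fun h => ?_⟩
  rw [h, Real.volume_univ] at hlt
  exact not_top_lt hlt

/-- For a fine enough free partition `Q` and a Perron partition `P` refining it, replacing the tags
of `P` by those of `Q` changes Riemann sums little, outside of a small exceptional set. -/
theorem exists_gauge_of_perronClose {ι : Type*} {F : ι → ℝ → ℝ} {φ : ι → ℝ} (meas : Prop)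
    (hF : ∀ t ∈ Icc (0:ℝ) 1, ∃ b, ∀ x, |F x t| ≤ b)
    (hH : ∀ ε > 0, ∃ δ : ℝ → ℝ, IsGauge δ ∧ (meas → AEMeasurable δ volume) ∧
      ∀ x, PerronClose δ (F x) (φ x) ε) {ε : ℝ} (hε : 0 < ε) :
    ∃ δ : ℝ → ℝ, IsGauge δ ∧ (∀ x, PerronClose δ (F x) (φ x) ε) ∧
      ∀ θ > 0, ∃ Δ : ℝ → ℝ, IsGauge Δ ∧ (meas → AEMeasurable Δ volume) ∧ (∀ t, Δ t ≤ δ t) ∧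
        ∀ (n : ℕ) (Q : TP n), Q.IsFine Δ → ∀ (m : ℕ) (P : TP m), P.IsPerron → P.IsFine δ →
        ∀ β : Fin m → Fin n, (∀ i, P.ivl i ⊆ Q.ivl (β i)) →
        ∃ bad : Finset (Fin m), ∑ i ∈ bad, P.len i ≤ θ ∧
          (∀ x, ∑ i ∈ bad, P.len i * |F x (Q.tag (β i))| ≤ θ) ∧
          ∀ T : Finset (Fin m), Disjoint T bad → ∀ x,
            |∑ i ∈ T, P.len i * (F x (Q.tag (β i)) - F x (P.tag i))| ≤ 3 * ε := by
  classical
  obtain ⟨δ, hδ, hδm, hδF⟩ := hH ε hε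
  refine ⟨δ, hδ, hδF, fun θ hθ => ?_⟩
  have hb : ∀ k : ℕ, ∃ b, 1 ≤ b ∧
      ∀ t ∈ Icc (0:ℝ) 1, (δ t)⁻¹ ≤ k → ∀ x, |F x t| ≤ b := by
    intro k
    obtain ⟨B, hB⟩ := exists_bound_of_perronClose hδ hF hδF
      (show (0:ℝ) < (k:ℝ) + 1 by positivity)
    exact ⟨max 1 B, le_max_left _ _,
      fun t ht htk x => (hB t ht (by linarith) x).trans (le_max_right _ _)⟩
  choose b hb1 hb using hb
  have hb0 : ∀ k, 0 < b k := fun k => one_pos.trans_le (hb1 k)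
  obtain ⟨e, he, E, hE, hEε⟩ := posSumOfEncodable hε ℕ
  have hη : ∀ k, 0 < e k / 2 * (e k / 2) / (20 * b k) := fun k => by
    have := he k; have := hb0 k; positivity
  choose d hd hdm hdF using fun k => hH _ (hη k)
  set kk : ℝ → ℕ := fun t => ⌈(δ t)⁻¹⌉₊ with hkk
  set qq : ℝ → ℕ := fun t => ⌈(d (kk t) t)⁻¹⌉₊ with hqq
  set A : ℕ × ℕ → Set ℝ := fun p => {t | t ∈ Icc (0:ℝ) 1 ∧ (δ t)⁻¹ ≤ p.1 ∧ (d p.1 t)⁻¹ ≤ p.2}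
    with hA
  have hAfin : ∀ p, volume (A p) ≠ ∞ := fun p =>
    measure_ne_top_of_subset (fun t ht => ht.1) (by simp : volume (Icc (0:ℝ) 1) ≠ ∞)
  obtain ⟨e', he', E', hE', hEθ⟩ := posSumOfEncodable hθ (ℕ × ℕ)
  have hth : ∀ p, 0 < e' p / b p.1 := fun p => div_pos (he' p) (hb0 _)
  choose G hAG hGo hGA hGc using fun p => exists_isOpen_volume_le (hAfin p) (hth p)
  set cl : ℝ → ℕ × ℕ := fun t => (kk t, qq t) with hcl
  have hclA : ∀ t ∈ Icc (0:ℝ) 1, t ∈ A (cl t) := fun t ht =>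
    ⟨ht, Nat.le_ceil _, Nat.le_ceil _⟩
  have hkpos : ∀ t ∈ Icc (0:ℝ) 1, (0:ℝ) < kk t := fun t ht =>
    (inv_pos.2 (hδ t ht)).trans_le (Nat.le_ceil _)
  have hqpos : ∀ t ∈ Icc (0:ℝ) 1, (0:ℝ) < qq t := fun t ht =>
    (inv_pos.2 (hd _ t ht)).trans_le (Nat.le_ceil _)
  let D : ℕ × ℕ → ℝ → ℝ := fun p t =>
    min ((p.1 : ℝ)⁻¹ / 4) (min ((p.2 : ℝ)⁻¹ / 4) (infDist t (G p)ᶜ))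
  have hDm : ∀ p, AEMeasurable (D p) volume := fun p =>
    (measurable_const.min (measurable_const.min
      (continuous_infDist_pt _).measurable)).aemeasurable
  refine ⟨fun t => min (δ t) (D (cl t) t), ?_, ?_, fun t => min_le_left _ _, ?_⟩
  · intro t ht
    have h1 := hkpos t ht
    have h2 := hqpos t ht
    refine lt_min (hδ t ht) (lt_min (by positivity) (lt_min (by positivity) ?_))
    rw [← (hGo _).isClosed_compl.notMem_iff_infDist_pos (hGc _)]
    exact fun h => h (hAG _ (hclA t ht))
  · intro hm
    have hkm : AEMeasurable kk volume := Nat.measurable_ceil.comp_aemeasurable (hδm hm).inv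
    have hqm : AEMeasurable qq volume := Nat.measurable_ceil.comp_aemeasurable
      (aemeasurable_apply_index hkm fun k => hdm k hm).inv
    exact (hδm hm).min (aemeasurable_apply_index (hkm.prodMk hqm) hDm)
  intro n Q hQ m P hP hPf β hβ
  set τ : Fin m → ℝ := fun i => Q.tag (β i) with hτ
  have hτ01 : ∀ i, τ i ∈ Icc (0:ℝ) 1 := fun i => Q.tagMem _
  have hfine : ∀ i, ∀ y ∈ P.ivl i, |y - τ i| < D (cl (τ i)) (τ i) := by
    intro i y hy
    have := hQ (β i) (hβ i hy)
    have hm := min_le_right (δ (τ i)) (D (cl (τ i)) (τ i))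
    rw [abs_lt]
    constructor <;> linarith [this.1, this.2]
  have hfk : ∀ i, ∀ y ∈ P.ivl i, |y - τ i| < (kk (τ i) : ℝ)⁻¹ / 4 := fun i y hy =>
    (hfine i y hy).trans_le (min_le_left _ _)
  have hfq : ∀ i, ∀ y ∈ P.ivl i, |y - τ i| < (qq (τ i) : ℝ)⁻¹ / 4 := fun i y hy =>
    (hfine i y hy).trans_le ((min_le_right _ _).trans (min_le_left _ _))
  have hfG : ∀ i, P.ivo i ⊆ G (cl (τ i)) := by
    intro i y hy
    refine ball_infDist_compl_subset (x := τ i) ?_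
    rw [mem_ball, Real.dist_eq]
    exact (hfine i y (P.ivo_subset_ivl i hy)).trans_le
      ((min_le_right _ _).trans (min_le_right _ _))
  set bad : Finset (Fin m) := Finset.univ.filter fun i => Disjoint (P.ivo i) (A (cl (τ i)))
    with hbad
  have hcls : ∀ p, ∑ i ∈ bad with cl (τ i) = p, P.len i ≤ e' p / b p.1 := by
    intro p
    refine P.sum_len_le_of_disjoint (hth p).le (hAfin p) (hAG p) (hGA p) ?_ ?_ <;> intro i hi <;>
      obtain ⟨hi1, rfl⟩ := Finset.mem_filter.1 hi
    exacts [hfG i, (Finset.mem_filter.1 hi1).2]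
  refine ⟨bad, ?_, fun x => ?_, fun T hT x => ?_⟩
  · refine (sum_le_of_fiber_le bad (fun i => cl (τ i)) _ (fun p => (he' p).le) hE'
      fun p => (hcls p).trans ?_).trans hEθ
    exact div_le_self (he' p).le (hb1 _)
  · refine (sum_le_of_fiber_le bad (fun i => cl (τ i)) _ (fun p => (he' p).le) hE'
      fun p => ?_).trans hEθ
    calc _ ≤ ∑ i ∈ bad with cl (τ i) = p, P.len i * b p.1 := by
          refine Finset.sum_le_sum fun i hi => mul_le_mul_of_nonneg_left ?_ (P.len_nonneg i)
          obtain ⟨-, rfl⟩ := Finset.mem_filter.1 hi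
          exact hb _ _ (hτ01 i) (Nat.le_ceil _) x
      _ ≤ e' p := by
          rw [← Finset.sum_mul, ← le_div_iff₀ (hb0 _)]
          exact hcls p
  · have hs : ∀ i, ∃ s, i ∈ T → s ∈ P.ivo i ∧ s ∈ A (cl (τ i)) := by
      intro i
      by_cases hi : i ∈ T
      · have h1 : i ∉ bad := Finset.disjoint_left.1 hT hi
        have h2 : ¬ Disjoint (P.ivo i) (A (cl (τ i))) := fun h =>
          h1 (Finset.mem_filter.2 ⟨Finset.mem_univ _, h⟩)
        obtain ⟨s, hs⟩ := Set.not_disjoint_iff.1 h2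
        exact ⟨s, fun _ => hs⟩
      · exact ⟨0, fun h => absurd h hi⟩
    choose s hs using hs
    have hsI : ∀ i ∈ T, s i ∈ P.ivl i := fun i hi => P.ivo_subset_ivl i (hs i hi).1
    have hsA : ∀ i ∈ T, s i ∈ A (cl (τ i)) := fun i hi => (hs i hi).2
    have h1 := (hδF x).sum_sub_le hP hPf (v := s) (T := T) (fun i hi => (hsA i hi).1) hsI
      (fun i hi y hy => by
        have h1 := abs_lt.1 (hfk i y hy)
        have h2 := abs_lt.1 (hfk i _ (hsI i hi))
        have h3 := inv_le_of_inv_le₀ (hδ _ (hsA i hi).1) (hsA i hi).2.1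
        have h4 : (0:ℝ) < (kk (τ i) : ℝ)⁻¹ := inv_pos.2 (hkpos _ (hτ01 i))
        simp only [hcl] at h3
        constructor <;> linarith [h1.1, h1.2, h2.1, h2.2])
    have h2 : ∑ i ∈ T, P.len i * |F x (s i) - F x (τ i)| ≤ ε := by
      refine (sum_le_of_fiber_le T (fun i => kk (τ i)) _ (fun k => (he k).le) hE
        fun k => ?_).trans hEε
      have hfil : ∀ i ∈ T.filter (fun i => kk (τ i) = k), i ∈ T ∧ kk (τ i) = k :=
        fun i hi => Finset.mem_filter.1 hi
      have hnear : ∀ i, ∀ y ∈ Icc (min (τ i) (P.pt i.castSucc)) (max (τ i) (P.pt i.succ)),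
          |y - τ i| < (qq (τ i) : ℝ)⁻¹ / 4 := by
        intro i y hy
        have hle := P.mono i.castSucc_le_succ
        have h1 := abs_lt.1 (hfq i _ (left_mem_Icc.2 hle))
        have h2 := abs_lt.1 (hfq i _ (right_mem_Icc.2 hle))
        have h4 : (0:ℝ) < (qq (τ i) : ℝ)⁻¹ := inv_pos.2 (hqpos _ (hτ01 i))
        rw [abs_lt]
        rcases min_le_iff.1 hy.1 with h | h <;> rcases le_max_iff.1 hy.2 with h' | h' <;>
          constructor <;> linarith [h1.1, h1.2, h2.1, h2.2]
      have hsub : ∀ i, P.ivl i ⊆ Icc (min (τ i) (P.pt i.castSucc)) (max (τ i) (P.pt i.succ)) :=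
        fun i => Icc_subset_Icc (min_le_right _ _) (le_max_right _ _)
      have key := (hdF k x).sum_len_mul_abs_le (hd k) P (T.filter fun i => kk (τ i) = k)
        (fun i => min (τ i) (P.pt i.castSucc)) (fun i => max (τ i) (P.pt i.succ)) s τ
        (fun i _ => hsub i)
        (fun i _ => Icc_subset_Icc (le_min (hτ01 i).1 (P.pt_mem _).1)
          (max_le (hτ01 i).2 (P.pt_mem _).2))
        (fun i hi => hsub i (hsI i (hfil i hi).1))
        (fun i _ => ⟨min_le_left _ _, le_max_left _ _⟩)
        (fun i hi y hy => by
          obtain ⟨hiT, rfl⟩ := hfil i hi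
          have h1 := abs_lt.1 (hnear i y hy)
          have h2 := abs_lt.1 (hfq i _ (hsI i hiT))
          have h3 := inv_le_of_inv_le₀ (hd _ _ (hsA i hiT).1) (hsA i hiT).2.2
          have h4 : (0:ℝ) < (qq (τ i) : ℝ)⁻¹ := inv_pos.2 (hqpos _ (hτ01 i))
          simp only [hcl] at h3
          constructor <;> linarith [h1.1, h1.2, h2.1, h2.2])
        (fun i hi y hy => by
          obtain ⟨hiT, rfl⟩ := hfil i hi
          have h1 := abs_lt.1 (hnear i y hy)
          have h3 := inv_le_of_inv_le₀ (hd _ _ (hτ01 i)) (hclA _ (hτ01 i)).2.2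
          have h4 : (0:ℝ) < (qq (τ i) : ℝ)⁻¹ := inv_pos.2 (hqpos _ (hτ01 i))
          simp only [hcl] at h3
          constructor <;> linarith [h1.1, h1.2])
        (b := b k)
        (fun i hi => by
          obtain ⟨hiT, rfl⟩ := hfil i hi
          exact hb _ _ (hsA i hiT).1 (hsA i hiT).2.1 x)
        (fun i hi => by
          obtain ⟨hiT, rfl⟩ := hfil i hi
          exact hb _ _ (hτ01 i) (Nat.le_ceil _) x)
        (hb0 k).le (half_pos (he k))
      refine key.trans (le_of_eq ?_)
      have := (hb0 k).ne'
      have := (he k).ne'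
      field_simp
      ring
    have h3 : |∑ i ∈ T, P.len i * (F x (s i) - F x (τ i))| ≤ ε := by
      refine (Finset.abs_sum_le_sum_abs _ _).trans (le_of_eq_of_le ?_ h2)
      refine Finset.sum_congr rfl fun i _ => ?_
      rw [abs_mul, abs_of_nonneg (P.len_nonneg i)]
    have h4 : ∑ i ∈ T, P.len i * (F x (τ i) - F x (P.tag i)) =
        -(∑ i ∈ T, P.len i * (F x (P.tag i) - F x (s i))) -
          ∑ i ∈ T, P.len i * (F x (s i) - F x (τ i)) := by
      rw [← Finset.sum_neg_distrib, ← Finset.sum_sub_distrib]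
      exact Finset.sum_congr rfl fun i _ => by ring
    rw [h4]
    rw [abs_le] at h1 h3 ⊢
    constructor <;> linarith [h1.1, h1.2, h3.1, h3.2]

/-- A pointwise bounded, uniformly Henstock integrable family of nonnegative functions is uniformly
McShane integrable. -/
theorem exists_gauge_forall_isFine {ι : Type*} {F : ι → ℝ → ℝ} {φ : ι → ℝ} (meas : Prop)
    (hF : ∀ t ∈ Icc (0:ℝ) 1, ∃ b, ∀ x, |F x t| ≤ b) (hF0 : ∀ x, ∀ t ∈ Icc (0:ℝ) 1, 0 ≤ F x t)
    (hH : ∀ ε > 0, ∃ δ : ℝ → ℝ, IsGauge δ ∧ (meas → AEMeasurable δ volume) ∧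
      ∀ x, PerronClose δ (F x) (φ x) ε) {ε : ℝ} (hε : 0 < ε) :
    ∃ δ : ℝ → ℝ, IsGauge δ ∧ (meas → AEMeasurable δ volume) ∧
      ∀ (n : ℕ) (Q : TP n), Q.IsFine δ → ∀ x, |fSum Q (F x) - φ x| ≤ 15 * ε := by
  classical
  obtain ⟨δ, hδ, hδF, hK⟩ := exists_gauge_of_perronClose meas hF hH hε
  obtain ⟨Δ₀, hΔ₀, -, hΔ₀δ, hK₀⟩ := hK ε hε
  obtain ⟨l, R, hR, hRf⟩ := TP.exists_perron hΔ₀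
  have hRfδ : R.IsFine δ := fun i => (hRf i).trans
    (Ioo_subset_Ioo (by linarith [hΔ₀δ (R.tag i)]) (by linarith [hΔ₀δ (R.tag i)]))
  choose B hB using fun i => hF (R.tag i) (R.tagMem i)
  set M : ℝ := 1 + ∑ i, |B i| with hM
  have hM1 : 1 ≤ M := le_add_of_nonneg_right (Finset.sum_nonneg fun i _ => abs_nonneg _)
  have hMB : ∀ i x, |F x (R.tag i)| ≤ M := fun i x => by
    have := Finset.single_le_sum (f := fun i => |B i|) (fun i _ => abs_nonneg _)
      (Finset.mem_univ i)
    linarith [hB i x, le_abs_self (B i)]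
  have hM0 : 0 < M := one_pos.trans_le hM1
  obtain ⟨Δ, hΔ, hΔm, -, hK₁⟩ := hK (min ε (ε / M)) (lt_min hε (div_pos hε hM0))
  refine ⟨Δ, hΔ, hΔm, fun n Q hQ x => ?_⟩
  obtain ⟨m, P, hP, hPf, ⟨α, hα⟩, β, hβ⟩ := R.exists_perron_refining hδ Q
  obtain ⟨bad₀, -, hb₀, hg₀⟩ := hK₀ l R hRf m P hP hPf α hα
  obtain ⟨bad₁, hl₁, hb₁, hg₁⟩ := hK₁ n Q hQ m P hP hPf β hβ
  have hSR : fSum R (F x) = ∑ i, P.len i * F x (R.tag (α i)) := by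
    rw [P.sum_len_mul_of_refines R hα fun j => F x (R.tag j)]
    simp [fSum]
  have hSQ : fSum Q (F x) = ∑ i, P.len i * F x (Q.tag (β i)) := by
    rw [P.sum_len_mul_of_refines Q hβ fun j => F x (Q.tag j)]
    simp [fSum]
  have hSP : fSum P (F x) = ∑ i, P.len i * F x (P.tag i) := by simp [fSum]
  have hR1 := abs_le.1 (hδF x l R hR hRfδ)
  have hP1 := abs_le.1 (hδF x m P hP hPf)
  have split : ∀ (T : Finset (Fin m)) (f : Fin m → ℝ),
      ∑ i, f i = ∑ i ∈ T, f i + ∑ i ∈ Tᶜ, f i := fun T f => (Finset.sum_add_sum_compl T f).symm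
  have hpos : ∀ i, 0 ≤ P.len i * F x (P.tag i) := fun i =>
    mul_nonneg (P.len_nonneg i) (hF0 x _ (P.tagMem i))
  have h1 : ∑ i ∈ bad₀, P.len i * F x (P.tag i) ≤ 6 * ε := by
    have e1 := abs_le.1 (hg₀ bad₀ᶜ disjoint_compl_left x)
    simp only [mul_sub, Finset.sum_sub_distrib] at e1
    have e2 : ∑ i ∈ bad₀, P.len i * F x (R.tag (α i)) ≤ ε :=
      (Finset.sum_le_sum fun i _ =>
        mul_le_mul_of_nonneg_left (le_abs_self _) (P.len_nonneg i)).trans (hb₀ x)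
    rw [hSR, split bad₀] at hR1
    rw [hSP, split bad₀] at hP1
    linarith [e1.1, e1.2, hR1.1, hR1.2, hP1.1, hP1.2]
  have h2 : ∑ i ∈ bad₁ \ bad₀, P.len i * F x (P.tag i) ≤ 4 * ε := by
    have e1 := abs_le.1 (hg₀ (bad₁ \ bad₀) Finset.sdiff_disjoint x)
    simp only [mul_sub, Finset.sum_sub_distrib] at e1
    have e2 : ∑ i ∈ bad₁ \ bad₀, P.len i * F x (R.tag (α i)) ≤ ε := by
      calc _ ≤ ∑ i ∈ bad₁ \ bad₀, P.len i * M := Finset.sum_le_sum fun i _ =>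
            mul_le_mul_of_nonneg_left ((le_abs_self _).trans (hMB _ x)) (P.len_nonneg i)
        _ ≤ ∑ i ∈ bad₁, P.len i * M := Finset.sum_le_sum_of_subset_of_nonneg
            Finset.sdiff_subset fun i _ _ => mul_nonneg (P.len_nonneg i) hM0.le
        _ ≤ ε := by
            rw [← Finset.sum_mul, ← le_div_iff₀ hM0]
            exact hl₁.trans (min_le_right _ _)
    linarith [e1.1, e1.2]
  have h3 : ∑ i ∈ bad₁, P.len i * F x (P.tag i) ≤ 10 * ε := by
    have e1 : ∑ i ∈ bad₁, P.len i * F x (P.tag i) ≤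
        ∑ i ∈ bad₀ ∪ (bad₁ \ bad₀), P.len i * F x (P.tag i) := by
      refine Finset.sum_le_sum_of_subset_of_nonneg ?_ fun i _ _ => hpos i
      rw [Finset.union_sdiff_self_eq_union]
      exact Finset.subset_union_right
    rw [Finset.sum_union Finset.disjoint_sdiff] at e1
    linarith
  have h3' : 0 ≤ ∑ i ∈ bad₁, P.len i * F x (P.tag i) := Finset.sum_nonneg fun i _ => hpos i
  have h4 : ∑ i ∈ bad₁, P.len i * F x (Q.tag (β i)) ≤ ε :=
    (Finset.sum_le_sum fun i _ =>
      mul_le_mul_of_nonneg_left (le_abs_self _) (P.len_nonneg i)).trans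
      ((hb₁ x).trans (min_le_left _ _))
  have h4' : 0 ≤ ∑ i ∈ bad₁, P.len i * F x (Q.tag (β i)) :=
    Finset.sum_nonneg fun i _ => mul_nonneg (P.len_nonneg i) (hF0 x _ (Q.tagMem _))
  have h5 := abs_le.1 (hg₁ bad₁ᶜ disjoint_compl_left x)
  simp only [mul_sub, Finset.sum_sub_distrib] at h5
  rw [hSP, split bad₁] at hP1
  rw [hSQ, split bad₁, abs_le]
  constructor <;> linarith [h5.1, h5.2, hP1.1, hP1.2]

theorem exists_gauge_abs_fSum_sub_le {ι : Type*} {F : ι → ℝ → ℝ} {N : Set ℝ}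
    (hN : volume N = 0) (hN01 : N ⊆ Icc (0:ℝ) 1)
    (hF : ∀ t ∈ Icc (0:ℝ) 1, ∃ b, ∀ x, |F x t| ≤ b) {ε : ℝ} (hε : 0 < ε) :
    ∃ δ : ℝ → ℝ, IsGauge δ ∧ AEMeasurable δ volume ∧ ∀ (n : ℕ) (P : TP n), P.IsFine δ →
      ∀ x, |fSum P (F x) - fSum P (Nᶜ.indicator (F x))| ≤ ε := by
  classical
  have hb : ∀ t, ∃ k : ℕ, t ∈ Icc (0:ℝ) 1 → ∀ x, |F x t| ≤ k + 1 := by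
    intro t
    by_cases ht : t ∈ Icc (0:ℝ) 1
    · obtain ⟨b, hb⟩ := hF t ht
      exact ⟨⌈b⌉₊, fun _ x => by linarith [hb x, Nat.le_ceil b]⟩
    · exact ⟨0, fun h => absurd h ht⟩
  choose k hk using hb
  obtain ⟨e, he, E, hE, hEε⟩ := posSumOfEncodable hε ℕ
  have hpos : ∀ j : ℕ, 0 < e j / (j + 1) := fun j => div_pos (he j) (by positivity)
  have h0 : ∀ j, volume {t ∈ N | k t = j} = 0 := fun j =>
    measure_mono_null (fun t ht => ht.1) hN
  choose G hNG hGo hGv hGc using fun j => exists_isOpen_volume_le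
    (A := {t ∈ N | k t = j}) (by simp [h0 j]) (hpos j)
  refine ⟨fun t => if t ∈ N then infDist t (G (k t))ᶜ else 1, fun t _ => ?_, ?_, ?_⟩
  · dsimp only
    split_ifs with h
    · rw [← (hGo _).isClosed_compl.notMem_iff_infDist_pos (hGc _)]
      exact fun h' => h' (hNG _ ⟨h, rfl⟩)
    · exact one_pos
  · refine (aemeasurable_const (b := (1:ℝ))).congr ?_
    filter_upwards [measure_eq_zero_iff_ae_notMem.1 hN] with t ht
    rw [if_neg ht]
  · intro n P hP x
    have h1 : fSum P (F x) - fSum P (Nᶜ.indicator (F x)) =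
        ∑ i with P.tag i ∈ N, P.len i * F x (P.tag i) := by
      rw [fSum, fSum, ← Finset.sum_sub_distrib, Finset.sum_filter]
      refine Finset.sum_congr rfl fun i _ => ?_
      by_cases hi : P.tag i ∈ N <;> simp [hi]
    rw [h1]
    refine (Finset.abs_sum_le_sum_abs _ _).trans (le_trans ?_ hEε)
    refine sum_le_of_fiber_le _ (fun i => k (P.tag i)) _ (fun j => (he j).le) hE fun j => ?_
    set T := (Finset.univ.filter fun i => P.tag i ∈ N).filter fun i => k (P.tag i) = j with hT
    have hTm : ∀ i ∈ T, P.tag i ∈ N ∧ k (P.tag i) = j := fun i hi => by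
      simpa [hT] using hi
    have h2 : ∑ i ∈ T, P.len i ≤ e j / (j + 1) := by
      refine P.sum_len_le_of_subset (V := G j) (fun i hi y hy => ?_) (hpos j).le
        ((hGv j).trans (by rw [h0, zero_add]))
      obtain ⟨hi1, rfl⟩ := hTm i hi
      have := hP i (P.ivo_subset_ivl i hy)
      simp only [if_pos hi1] at this
      refine ball_infDist_compl_subset (x := P.tag i) ?_
      rwa [Real.ball_eq_Ioo]
    calc ∑ i ∈ T, |P.len i * F x (P.tag i)| ≤ ∑ i ∈ T, P.len i * (j + 1) := by
          refine Finset.sum_le_sum fun i hi => ?_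
          obtain ⟨hi1, rfl⟩ := hTm i hi
          rw [abs_mul, abs_of_nonneg (P.len_nonneg i)]
          exact mul_le_mul_of_nonneg_left (hk _ (hN01 hi1) x) (P.len_nonneg i)
      _ ≤ e j := by
          rw [← Finset.sum_mul, ← le_div_iff₀ (by positivity)]
          exact h2

theorem TP.IsFine.mono {n : ℕ} {P : TP n} {δ δ' : ℝ → ℝ} (h : P.IsFine δ) (hδ : ∀ t, δ t ≤ δ' t) :
    P.IsFine δ' := fun i => (h i).trans
  (Ioo_subset_Ioo (by linarith [hδ (P.tag i)]) (by linarith [hδ (P.tag i)]))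

theorem exists_gauge_forall_isFine_of_ae {ι : Type*} {F : ι → ℝ → ℝ} {φ : ι → ℝ} (meas : Prop)
    (hF : ∀ t ∈ Icc (0:ℝ) 1, ∃ b, ∀ x, |F x t| ≤ b)
    (hF0 : ∀ᵐ t ∂(volume.restrict (Icc (0:ℝ) 1)), ∀ x, 0 ≤ F x t)
    (hH : ∀ ε > 0, ∃ δ : ℝ → ℝ, IsGauge δ ∧ (meas → AEMeasurable δ volume) ∧
      ∀ x, PerronClose δ (F x) (φ x) ε) {ε : ℝ} (hε : 0 < ε) :
    ∃ δ : ℝ → ℝ, IsGauge δ ∧ (meas → AEMeasurable δ volume) ∧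
      ∀ (n : ℕ) (Q : TP n), Q.IsFine δ → ∀ x, |fSum Q (F x) - φ x| ≤ ε := by
  classical
  rw [ae_restrict_iff' measurableSet_Icc] at hF0
  set N : Set ℝ := {t | ¬(t ∈ Icc (0:ℝ) 1 → ∀ x, 0 ≤ F x t)} with hN
  have hN0 : volume N = 0 := hF0
  have hN01 : N ⊆ Icc (0:ℝ) 1 := fun t ht => by
    by_contra h
    exact ht fun h' => absurd h' h
  have hNF : ∀ ε > 0, ∃ δ : ℝ → ℝ, IsGauge δ ∧ AEMeasurable δ volume ∧ ∀ (n : ℕ) (P : TP n),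
      P.IsFine δ → ∀ x, |fSum P (F x) - fSum P (Nᶜ.indicator (F x))| ≤ ε :=
    fun ε hε => exists_gauge_abs_fSum_sub_le hN0 hN01 hF hε
  have hF' : ∀ t ∈ Icc (0:ℝ) 1, ∃ b, ∀ x, |Nᶜ.indicator (F x) t| ≤ b := by
    intro t ht
    obtain ⟨b, hb⟩ := hF t ht
    refine ⟨b, fun x => ?_⟩
    rw [indicator_apply]
    split_ifs
    exacts [hb x, by simpa using (abs_nonneg _).trans (hb x)]
  have hF0' : ∀ x, ∀ t ∈ Icc (0:ℝ) 1, 0 ≤ Nᶜ.indicator (F x) t := by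
    refine fun x t ht => indicator_apply_nonneg fun h => ?_
    have h : t ∈ Icc (0:ℝ) 1 → ∀ x, 0 ≤ F x t := not_not.1 h
    exact h ht x
  have hH' : ∀ η > 0, ∃ δ : ℝ → ℝ, IsGauge δ ∧ (meas → AEMeasurable δ volume) ∧
      ∀ x, PerronClose δ (Nᶜ.indicator (F x)) (φ x) η := by
    intro η hη
    obtain ⟨δ, hδ, hδm, hδF⟩ := hH (η / 2) (by positivity)
    obtain ⟨ρ, hρ, hρm, hρF⟩ := hNF (η / 2) (by positivity)
    refine ⟨fun t => min (δ t) (ρ t), fun t ht => lt_min (hδ t ht) (hρ t ht),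
      fun h => (hδm h).min hρm, fun x n P hP hPf => ?_⟩
    have h1 := abs_le.1 (hδF x n P hP (hPf.mono fun t => min_le_left _ _))
    have h2 := abs_le.1 (hρF n P (hPf.mono fun t => min_le_right _ _) x)
    rw [abs_le]
    constructor <;> linarith [h1.1, h1.2, h2.1, h2.2]
  obtain ⟨δ, hδ, hδm, hδF⟩ := exists_gauge_forall_isFine meas hF' hF0' hH'
    (show 0 < ε / 30 by positivity)
  obtain ⟨ρ, hρ, hρm, hρF⟩ := hNF (ε / 2) (by positivity)
  refine ⟨fun t => min (δ t) (ρ t), fun t ht => lt_min (hδ t ht) (hρ t ht),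
    fun h => (hδm h).min hρm, fun n Q hQ x => ?_⟩
  have h1 := abs_le.1 (hδF n Q (hQ.mono fun t => min_le_left _ _) x)
  have h2 := abs_le.1 (hρF n Q (hQ.mono fun t => min_le_right _ _) x)
  rw [abs_le]
  constructor <;> linarith [h1.1, h1.2, h2.1, h2.2]

theorem IsCWK.isBounded {A : Set X} (hA : IsCWK X A) : Bornology.IsBounded A := by
  have h : ∀ f : StrongDual ℝ X, ∃ C, ∀ a : A,
      ‖NormedSpace.inclusionInDoubleDualLi ℝ (a : X) f‖ ≤ C := by
    intro f
    have hf : Continuous fun y : WeakSpace ℝ X => f ((toWeakSpace ℝ X).symm y) :=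
      WeakBilin.eval_continuous (topDualPairing ℝ X).flip f
    obtain ⟨C, hC⟩ := (hA.2.2.image hf).isBounded.exists_norm_le
    refine ⟨C, fun a => hC _ ?_⟩
    rw [← image_comp]
    exact ⟨a, a.2, rfl⟩
  obtain ⟨C, hC⟩ := banach_steinhaus h
  refine isBounded_iff_forall_norm_le.2 ⟨C, fun a ha => ?_⟩
  exact ((NormedSpace.inclusionInDoubleDualLi ℝ).norm_map a).symm.trans_le (hC ⟨a, ha⟩)

section suppFn

variable {A B : Set X} (x' : X →L[ℝ] ℝ)

theorem bddAbove_image_of_isBounded (hA : Bornology.IsBounded A) : BddAbove (x' '' A) :=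
  (x'.lipschitz.isBounded_image hA).bddAbove

theorem le_suppFn (hA : Bornology.IsBounded A) {a : X} (ha : a ∈ A) : x' a ≤ suppFn x' A :=
  le_csSup (bddAbove_image_of_isBounded x' hA) (mem_image_of_mem _ ha)

theorem suppFn_le (hA : A.Nonempty) {c : ℝ} (h : ∀ a ∈ A, x' a ≤ c) : suppFn x' A ≤ c :=
  csSup_le (hA.image _) (by simpa using h)

theorem suppFn_add (hA : A.Nonempty) (hA' : Bornology.IsBounded A) (hB : B.Nonempty)
    (hB' : Bornology.IsBounded B) : suppFn x' (A + B) = suppFn x' A + suppFn x' B := by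
  rw [suppFn, image_add, csSup_add (hA.image _) (bddAbove_image_of_isBounded x' hA')
    (hB.image _) (bddAbove_image_of_isBounded x' hB')]
  rfl

theorem suppFn_smul {c : ℝ} (hc : 0 ≤ c) : suppFn x' (c • A) = c * suppFn x' A := by
  rw [suppFn, image_smul_set, Real.sSup_smul_of_nonneg hc]
  rfl

theorem abs_suppFn_le (hA : A.Nonempty) {b : ℝ} (hb : ∀ a ∈ A, ‖a‖ ≤ b) (hx : ‖x'‖ ≤ 1) :
    |suppFn x' A| ≤ b := by
  have h : ∀ a ∈ A, |x' a| ≤ b := fun a ha =>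
    (x'.le_of_opNorm_le hx a).trans (by simpa using hb a ha)
  have hA' : Bornology.IsBounded A := isBounded_iff_forall_norm_le.2 ⟨b, hb⟩
  obtain ⟨a, ha⟩ := hA
  exact abs_le.2 ⟨(abs_le.1 (h a ha)).1.trans (le_suppFn x' hA' ha),
    suppFn_le x' ⟨a, ha⟩ fun a ha => (abs_le.1 (h a ha)).2⟩

theorem suppFn_le_add_of_hausdorffDist_lt (hA : A.Nonempty) (hA' : Bornology.IsBounded A)
    (hB : B.Nonempty) (hB' : Bornology.IsBounded B) {ε : ℝ} (h : hausdorffDist A B < ε)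
    (hx : ‖x'‖ ≤ 1) : suppFn x' A ≤ suppFn x' B + ε := by
  refine suppFn_le x' hA fun a ha => ?_
  obtain ⟨b, hb, hab⟩ := exists_dist_lt_of_hausdorffDist_lt ha h
    (hausdorffEDist_ne_top_of_nonempty_of_bounded hA hB hA' hB')
  have h1 := (abs_le.1 (x'.le_of_opNorm_le hx (a - b))).2
  rw [map_sub, one_mul, ← dist_eq_norm] at h1
  linarith [le_suppFn x' hB' hb]

theorem mul_norm_le_of_forall_ball {r c : ℝ} (hr : 0 < r) (h : ∀ z ∈ ball (0:X) r, x' z ≤ c) :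
    r * ‖x'‖ ≤ c := by
  rw [← le_div_iff₀' hr]
  refine le_of_forall_lt fun s hs => ?_
  obtain ⟨x, hx, hsx⟩ := x'.exists_lt_apply_of_lt_opNorm hs
  refine hsx.trans_le ?_
  have hmem : ∀ y : X, ‖y‖ < 1 → x' y ≤ c / r := by
    intro y hy
    have := h (r • y) (by
      rw [mem_ball_zero_iff, norm_smul, Real.norm_of_nonneg hr.le]
      exact mul_lt_of_lt_one_right hr hy)
    rw [map_smul, smul_eq_mul] at this
    rwa [le_div_iff₀' hr]
  rw [Real.norm_eq_abs, abs_le']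
  exact ⟨hmem x hx, by simpa using hmem (-x) (by simpa using hx)⟩

theorem infDist_le_of_suppFn_le (hA : Bornology.IsBounded A) (hB : B.Nonempty)
    (hBc : Convex ℝ B) {ε : ℝ} (hε : 0 ≤ ε)
    (h : ∀ x' : X →L[ℝ] ℝ, ‖x'‖ ≤ 1 → suppFn x' A ≤ suppFn x' B + ε) {a : X} (ha : a ∈ A) :
    infDist a B ≤ ε := by
  by_contra! hlt
  set r := infDist a B with hr
  have hr0 : 0 < r := hε.trans_lt hlt
  obtain ⟨f, u, hf1, hf2⟩ := geometric_hahn_banach_open (convex_ball a r) isOpen_ball hBc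
    disjoint_ball_infDist
  have hf0 : 0 < ‖f‖ := by
    obtain ⟨b, hb⟩ := hB
    rw [norm_pos_iff]
    rintro rfl
    have h1 := hf1 a (mem_ball_self hr0)
    have h2 := hf2 b hb
    simp only [zero_apply] at h1 h2
    linarith
  have h1 : r * ‖f‖ ≤ u - f a := mul_norm_le_of_forall_ball f hr0 fun z hz => by
    have := hf1 (a + z) (by simpa [mem_ball_iff_norm] using hz)
    rw [map_add] at this
    linarith
  set g : X →L[ℝ] ℝ := (-‖f‖⁻¹) • f with hg
  have hgv : ∀ y, g y = -(f y / ‖f‖) := fun y => by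
    simp [hg, div_eq_inv_mul]
  have hg1 : ‖g‖ ≤ 1 := by
    rw [hg, norm_smul, norm_neg, norm_inv, norm_norm, inv_mul_cancel₀ hf0.ne']
  have h2 : suppFn g B ≤ -(u / ‖f‖) := suppFn_le g hB fun b hb => by
    rw [hgv]
    exact neg_le_neg (div_le_div_of_nonneg_right (hf2 b hb) hf0.le)
  have h3 := le_suppFn g hA ha
  have h4 := h g hg1
  rw [hgv] at h3
  rw [← le_div_iff₀ hf0, sub_div] at h1
  linarith

theorem hausdorffDist_le_of_abs_suppFn_sub_le (hA : A.Nonempty) (hA' : Bornology.IsBounded A)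
    (hAc : Convex ℝ A) (hB : B.Nonempty) (hB' : Bornology.IsBounded B) (hBc : Convex ℝ B)
    {ε : ℝ} (hε : 0 ≤ ε)
    (h : ∀ x' : X →L[ℝ] ℝ, ‖x'‖ ≤ 1 → |suppFn x' A - suppFn x' B| ≤ ε) :
    hausdorffDist A B ≤ ε :=
  hausdorffDist_le_of_infDist hε
    (fun _ ha => infDist_le_of_suppFn_le hA' hB hBc hε
      (fun x' hx => by linarith [(abs_le.1 (h x' hx)).2]) ha)
    (fun _ hb => infDist_le_of_suppFn_le hB' hA hAc hε
      (fun x' hx => by linarith [(abs_le.1 (h x' hx)).1]) hb)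

end suppFn

theorem sum_nonempty_isBounded_convex {α : Type*} (s : Finset α) {f : α → Set X}
    (hf : ∀ i, (f i).Nonempty) (hb : ∀ i, Bornology.IsBounded (f i))
    (hc : ∀ i, Convex ℝ (f i)) :
    (∑ i ∈ s, f i).Nonempty ∧ Bornology.IsBounded (∑ i ∈ s, f i) ∧ Convex ℝ (∑ i ∈ s, f i) ∧
      ∀ x' : X →L[ℝ] ℝ, suppFn x' (∑ i ∈ s, f i) = ∑ i ∈ s, suppFn x' (f i) := by
  classical
  induction s using Finset.induction_on with
  | empty =>
    refine ⟨by simp, ?_, ?_, fun x' => ?_⟩ <;> rw [Finset.sum_empty]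
    · exact Bornology.isBounded_singleton
    · exact convex_singleton 0
    · simp [suppFn]
  | insert i s hi ih =>
    obtain ⟨h1, h2, h3, h4⟩ := ih
    rw [Finset.sum_insert hi]
    refine ⟨(hf i).add h1, (hb i).add h2, (hc i).add h3, fun x' => ?_⟩
    rw [suppFn_add x' (hf i) (hb i) h1 h2, h4, Finset.sum_insert hi]

theorem mSum_nonempty_isBounded_convex {Γ : ℝ → Set X} (hΓ : ∀ t ∈ Icc (0:ℝ) 1, IsCWK X (Γ t))
    {n : ℕ} (P : TP n) :
    (mSum P Γ).Nonempty ∧ Bornology.IsBounded (mSum P Γ) ∧ Convex ℝ (mSum P Γ) ∧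
      ∀ x' : X →L[ℝ] ℝ, suppFn x' (mSum P Γ) = fSum P fun t => suppFn x' (Γ t) := by
  have h := fun i => hΓ _ (P.tagMem i)
  obtain ⟨h1, h2, h3, h4⟩ := sum_nonempty_isBounded_convex Finset.univ
    (f := fun i => P.len i • Γ (P.tag i)) (fun i => (h i).1.smul_set)
    (fun i => (h i).isBounded.smul₀ _) (fun i => (h i).2.1.smul _)
  refine ⟨h1, h2, h3, fun x' => (h4 x').trans (Finset.sum_congr rfl fun i _ => ?_)⟩
  exact suppFn_smul x' (P.len_nonneg i)

theorem exists_gauge_hausdorffDist_lt (meas : Prop) {Γ : ℝ → Set X}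
    (hΓ : ∀ t ∈ Icc (0:ℝ) 1, IsCWK X (Γ t))
    (h0 : ∀ᵐ t ∂(volume.restrict (Icc (0:ℝ) 1)), (0:X) ∈ Γ t) {I : Set X} (hI : IsCWK X I)
    (hH : ∀ ε > 0, ∃ δ : ℝ → ℝ, IsGauge δ ∧ (meas → AEMeasurable δ volume) ∧
      ∀ (n : ℕ) (P : TP n), P.IsPerron → P.IsFine δ → hausdorffDist I (mSum P Γ) < ε)
    {ε : ℝ} (hε : 0 < ε) :
    ∃ δ : ℝ → ℝ, IsGauge δ ∧ (meas → AEMeasurable δ volume) ∧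
      ∀ (n : ℕ) (P : TP n), P.IsFine δ → hausdorffDist I (mSum P Γ) < ε := by
  have hb : ∀ t ∈ Icc (0:ℝ) 1, ∃ b, ∀ x' : {x' : X →L[ℝ] ℝ // ‖x'‖ ≤ 1},
      |suppFn x'.1 (Γ t)| ≤ b := by
    intro t ht
    obtain ⟨b, hb⟩ := (hΓ t ht).isBounded.exists_norm_le
    exact ⟨b, fun x' => abs_suppFn_le x'.1 (hΓ t ht).1 hb x'.2⟩
  have hpos : ∀ᵐ t ∂(volume.restrict (Icc (0:ℝ) 1)), ∀ x' : {x' : X →L[ℝ] ℝ // ‖x'‖ ≤ 1},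
      0 ≤ suppFn x'.1 (Γ t) := by
    filter_upwards [h0, ae_restrict_mem measurableSet_Icc] with t ht ht' x'
    simpa using le_suppFn x'.1 (hΓ t ht').isBounded ht
  have hclose : ∀ η > 0, ∃ δ : ℝ → ℝ, IsGauge δ ∧ (meas → AEMeasurable δ volume) ∧
      ∀ x' : {x' : X →L[ℝ] ℝ // ‖x'‖ ≤ 1},
        PerronClose δ (fun t => suppFn x'.1 (Γ t)) (suppFn x'.1 I) η := by
    intro η hη
    obtain ⟨δ, hδ, hδm, hδF⟩ := hH η hη
    refine ⟨δ, hδ, hδm, fun x' n P hP hPf => ?_⟩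
    obtain ⟨h1, h2, -, h4⟩ := mSum_nonempty_isBounded_convex hΓ P
    have h := hδF n P hP hPf
    have e1 := suppFn_le_add_of_hausdorffDist_lt x'.1 hI.1 hI.isBounded h1 h2 h x'.2
    rw [hausdorffDist_comm] at h
    have e2 := suppFn_le_add_of_hausdorffDist_lt x'.1 h1 h2 hI.1 hI.isBounded h x'.2
    rw [h4] at e1 e2
    rw [abs_le]
    constructor <;> linarith
  obtain ⟨δ, hδ, hδm, hδF⟩ := exists_gauge_forall_isFine_of_ae meas hb hpos hclose (half_pos hε)
  refine ⟨δ, hδ, hδm, fun n P hP => lt_of_le_of_lt ?_ (half_lt_self hε)⟩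
  obtain ⟨h1, h2, h3, h4⟩ := mSum_nonempty_isBounded_convex hΓ P
  refine hausdorffDist_le_of_abs_suppFn_sub_le hI.1 hI.isBounded hI.2.1 h1 h2 h3
    (half_pos hε).le fun x' hx => ?_
  rw [h4, abs_sub_comm]
  exact hδF n P hP ⟨x', hx⟩

/-- Proposition 3.2 of the paper. If `Γ : [0,1] → cwk(X)` satisfies
`0 ∈ Γ(t)` for a.e. `t`, then Henstock integrability of `Γ` implies McShane integrability,
and `ℋ`-integrability implies Birkhoff (`ℳ`-) integrability. -/
theorem henstock_to_mcshane_of_zero_mem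
    {X : Type*} [NormedAddCommGroup X] [NormedSpace ℝ X] [CompleteSpace X]
    (Γ : ℝ → Set X) (hΓ : ∀ t ∈ Icc (0:ℝ) 1, IsCWK X (Γ t))
    (h0 : ∀ᵐ t ∂(volume.restrict (Icc (0:ℝ) 1)), (0:X) ∈ Γ t) :
    (HenstockIntegrable Γ → McShaneIntegrable Γ) ∧
    (HMeasIntegrable Γ → BirkhoffIntegrable Γ) := by
  refine ⟨fun ⟨I, hI, h⟩ => ⟨I, hI, fun ε hε => ?_⟩,
    fun ⟨I, hI, h⟩ => ⟨I, hI, fun ε hε => ?_⟩⟩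
  · obtain ⟨δ, hδ, -, hδF⟩ := exists_gauge_hausdorffDist_lt False hΓ h0 hI (fun η hη => by
      obtain ⟨δ, hδ, hδF⟩ := h η hη
      exact ⟨δ, hδ, False.elim, hδF⟩) hε
    exact ⟨δ, hδ, hδF⟩
  · obtain ⟨δ, hδ, hδm, hδF⟩ := exists_gauge_hausdorffDist_lt True hΓ h0 hI (fun η hη => by
      obtain ⟨δ, hδ, hδm, hδF⟩ := h η hη
      exact ⟨δ, hδ, fun _ => hδm, hδF⟩) hε
    exact ⟨δ, hδ, hδm trivial, hδF⟩

end GaugePaper
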